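/- arXiv:2306.09972 — 2 statements merged into one kernel-verified Lean document; each statement's English description precedes it below -/
import Mathlib

section
/- Let q = 2^m with m ≥ 19 and let K be a finite field with q^3 elements. Let A, B ∈ K be nonzero. Then f_{A,B}(x) = x^(q^2−q+1) + A·x^(q^2) + B·x is a bijection of K if and only if one of the following holds: (i) A^(1+q+q^2) = B^(1+q+q^2), (A^q·B)^q = A^q·B, A^q·B ≠ 0 and A^q·B ≠ 1; or (ii) A^q·B = 1 and B^(1+q+q^2) ≠ 1. -/
open Polynomial

/-- The additive map `y ↦ ∑_{i<m} y^(2^i)`, i.e. the absolute trace on the field with `2^m`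
elements. -/
def absTrace {R : Type*} [CommSemiring R] (m : ℕ) (y : R) : R :=
  ∑ i ∈ Finset.range m, y ^ 2 ^ i

section AbsTrace

variable {R : Type*} [CommRing R] [CharP R 2]

theorem absTrace_add (m : ℕ) (x y : R) :
    absTrace m (x + y) = absTrace m x + absTrace m y := by
  simp only [absTrace, ← Finset.sum_add_distrib, add_pow_char_pow]

theorem absTrace_sq_add_self (m : ℕ) (y : R) :
    absTrace m (y ^ 2) + absTrace m y = y ^ 2 ^ m + y := by
  have h1 := Finset.sum_range_succ (fun i => y ^ 2 ^ i) m
  have h2 := Finset.sum_range_succ' (fun i => y ^ 2 ^ i) m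
  have h3 : absTrace m (y ^ 2) = ∑ i ∈ Finset.range m, y ^ 2 ^ (i + 1) := by
    refine Finset.sum_congr rfl fun i _ => ?_
    rw [← pow_mul, ← pow_succ']
  simp only [pow_zero, pow_one] at h2
  rw [h3, absTrace]
  grind

theorem absTrace_sq {m : ℕ} {y : R} (hy : y ^ 2 ^ m = y) :
    absTrace m (y ^ 2) = absTrace m y := by
  have := absTrace_sq_add_self m y
  rw [hy, CharTwo.add_self_eq_zero] at this
  exact CharTwo.add_eq_zero.1 this

end AbsTrace

section Stepanov

variable {K : Type*} [Field K] [CharP K 2] {m : ℕ} {S : Finset K}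

theorem exists_eq_mul_of_eval_eq_zero {q : ℕ} (hq : 1 < q) (hcard : S.card = q)
    (hS : ∀ s ∈ S, s ^ q = s) {G : K[X]} (hG : ∀ s ∈ S, G.eval s = 0) :
    ∃ H : K[X], G = (X ^ q + X) * H ∧ H.natDegree = G.natDegree - q := by
  have hdeg : (X : K[X]).degree < q := by
    rw [degree_X]; exact_mod_cast hq
  have hZ : (X ^ q + X : K[X]).Monic := monic_X_pow_add hdeg
  have hZd : (X ^ q + X : K[X]).natDegree = q := by
    rw [natDegree_add_eq_left_of_natDegree_lt] <;> simp [hq]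
  have hmod := modByMonic_add_div G (X ^ q + X)
  have h0 : G %ₘ (X ^ q + X) = 0 := by
    refine eq_zero_of_natDegree_lt_card_of_eval_eq_zero' _ S (fun s hs => ?_) ?_
    · have := congrArg (eval s) hmod
      simpa [hS s hs, hG s hs, CharTwo.add_self_eq_zero] using this
    · rw [hcard]
      nth_rewrite 2 [← hZd]
      refine natDegree_modByMonic_lt _ hZ (fun h => ?_)
      rw [h, natDegree_one] at hZd
      omega
  refine ⟨G /ₘ (X ^ q + X), ?_, ?_⟩
  · rw [h0, zero_add] at hmod
    exact hmod.symm
  · rw [natDegree_divByMonic _ hZ, hZd]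

theorem derivative_X_pow_two_pow_add_X (hm : 1 ≤ m) :
    derivative (X ^ 2 ^ m + X : K[X]) = 1 := by
  obtain ⟨n, rfl⟩ := Nat.exists_eq_add_of_le' hm
  have h2 : (2 : K) = 0 := CharTwo.two_eq_zero
  simp [derivative_pow, h2]

theorem derivative_pow_two_pow {n : ℕ} (hn : 1 ≤ n) (P : K[X]) :
    derivative (P ^ 2 ^ n) = 0 := by
  obtain ⟨n, rfl⟩ := Nat.exists_eq_add_of_le' hn
  have h2 : (2 : K) = 0 := CharTwo.two_eq_zero
  simp [derivative_pow, h2]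

theorem derivative_sq_eq_zero (P : K[X]) : derivative (P ^ 2) = 0 := by
  simpa using derivative_pow_two_pow (n := 1) le_rfl P

/-- If a rational function `P / D` with cubic denominator has constant absolute trace on the field
with `2^m` elements, where `D` has no zero, then `P` vanishes at the simple zeros of `D`. -/
theorem eval_eq_zero_of_absTrace_eq_const (hm : 4 ≤ m) (hcard : S.card = 2 ^ m)
    (hS : ∀ s ∈ S, s ^ 2 ^ m = s) {P D : K[X]} (hP : P.natDegree ≤ 3) (hD : D.natDegree ≤ 3)
    (hD0 : ∀ s ∈ S, D.eval s ≠ 0) (hDS : ∀ s ∈ S, D.eval s ^ 2 ^ m = D.eval s) {c : K}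
    (hc : ∀ s ∈ S, absTrace m (P.eval s / D.eval s) = c) {θ : K} (hθ : D.eval θ = 0)
    (hθ' : (derivative D).eval θ ≠ 0) : P.eval θ = 0 := by
  obtain ⟨n, rfl⟩ := Nat.exists_eq_add_of_le' (show 1 ≤ m by omega)
  have hq : 2 ^ 4 ≤ 2 ^ (n + 1) := Nat.pow_le_pow_right (by norm_num) hm
  have hqn : 2 ^ (n + 1) = 2 * 2 ^ n := pow_succ' 2 n
  set E : K[X] := D ^ (2 ^ n - 1) with hE
  have hDE : D * E = D ^ 2 ^ n := by
    rw [hE, ← pow_succ', Nat.sub_add_cancel Nat.one_le_two_pow]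
  set U : K[X] := ∑ i ∈ Finset.range n, P ^ 2 ^ (i + 1) * D ^ (2 ^ n - 2 ^ (i + 1)) with hU
  set G : K[X] := U + P * E + C c * D ^ 2 ^ n with hG
  have hle : ∀ i ∈ Finset.range n, 2 ^ (i + 1) ≤ 2 ^ n := fun i hi =>
    Nat.pow_le_pow_right (by norm_num) (Finset.mem_range.1 hi)
  have hU' : derivative U = 0 := by
    rw [hU, derivative_sum]
    refine Finset.sum_eq_zero fun i hi => ?_
    have : 2 ^ n - 2 ^ (i + 1) = (2 ^ (n - 1) - 2 ^ i) * 2 := by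
      have : 2 ^ n = 2 ^ (n - 1) * 2 := by
        rw [← pow_succ]; congr 1; omega
      rw [this, pow_succ, Nat.sub_mul]
    rw [this, pow_mul, derivative_mul, derivative_sq_eq_zero,
      derivative_pow_two_pow (by omega)]
    simp
  have hE' : derivative D * E + D * derivative E = 0 := by
    rw [← derivative_mul, hDE, derivative_pow_two_pow (by omega)]
  have hG' : D * derivative G = E * (derivative P * D + P * derivative D) := by
    have : derivative G = derivative P * E + P * derivative E := by
      simp [hG, hU', derivative_mul, derivative_pow_two_pow (show 1 ≤ n by omega)]
    rw [this]
    grind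
  have hGdeg : G.natDegree ≤ 3 * 2 ^ n := by
    refine natDegree_add_le_of_degree_le (natDegree_add_le_of_degree_le ?_ ?_) ?_
    · refine natDegree_sum_le_of_forall_le _ _ fun i hi => ?_
      refine natDegree_mul_le.trans ?_
      have h1 := natDegree_pow_le_of_le (2 ^ (i + 1)) hP
      have h2 := natDegree_pow_le_of_le (2 ^ n - 2 ^ (i + 1)) hD
      have := hle i hi
      omega
    · refine natDegree_mul_le.trans ?_
      have h2 : E.natDegree ≤ _ := natDegree_pow_le_of_le (2 ^ n - 1) hD
      have := Nat.one_le_two_pow (n := n)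
      omega
    · refine natDegree_C_mul_le _ _ |>.trans ?_
      have h2 := natDegree_pow_le_of_le (2 ^ n) hD
      omega
  have hGS : ∀ s ∈ S, G.eval s = 0 := by
    intro s hs
    have hD0s := hD0 s hs
    have hcs := hc s hs
    rw [absTrace, Finset.sum_range_succ'] at hcs
    have key : ∀ i, 2 ^ i ≤ 2 ^ n → eval s P ^ 2 ^ i * eval s D ^ (2 ^ n - 2 ^ i) =
        (eval s P / eval s D) ^ 2 ^ i * eval s D ^ 2 ^ n := by
      intro i hi
      rw [pow_sub₀ _ hD0s hi, div_pow]
      field_simp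
    have hUs : eval s U = (∑ i ∈ Finset.range n, (eval s P / eval s D) ^ 2 ^ (i + 1)) *
        eval s D ^ 2 ^ n := by
      rw [hU, eval_finsetSum, Finset.sum_mul]
      refine Finset.sum_congr rfl fun i hi => ?_
      rw [eval_mul, eval_pow, eval_pow, key _ (hle i hi)]
    have h0 := key 0 Nat.one_le_two_pow
    simp only [pow_zero, pow_one] at h0 hcs
    simp only [hG, hE, eval_add, eval_mul, eval_pow, eval_C, hUs, h0, ← hcs]
    rw [← add_mul, CharTwo.add_self_eq_zero]
  obtain ⟨H, hH, hHdeg⟩ := exists_eq_mul_of_eval_eq_zero (by omega) hcard hS hGS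
  set W : K[X] := derivative P * D + P * derivative D with hW
  have hP' : (derivative P).natDegree ≤ 2 := (natDegree_derivative_le P).trans (by omega)
  have hD' : (derivative D).natDegree ≤ 2 := (natDegree_derivative_le D).trans (by omega)
  have hWdeg : W.natDegree ≤ 5 := natDegree_add_le_of_degree_le
    (natDegree_mul_le.trans (by omega)) (natDegree_mul_le.trans (by omega))
  have hWS : ∀ s ∈ S, (H ^ 2 * D ^ 3 + W ^ 2).eval s = 0 := by
    intro s hs
    have e1 : eval s (derivative G) = eval s H := by
      rw [hH, derivative_mul, derivative_X_pow_two_pow_add_X (by omega)]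
      simp [hS s hs, CharTwo.add_self_eq_zero]
    have e2 := congrArg (eval s) hG'
    have e3 := congrArg (eval s) hDE
    simp only [eval_mul, eval_pow, e1] at e2 e3
    have e4 : (eval s D ^ 2 ^ n) ^ 2 = eval s D := by
      rw [← pow_mul, ← pow_succ, hDS s hs]
    have e5 : eval s D * (eval s H ^ 2 * eval s D ^ 3 + eval s W ^ 2) = 0 := by
      rw [← e3] at e4
      grind
    simpa [hD0 s hs] using e5
  obtain ⟨R, hR, hRdeg⟩ := exists_eq_mul_of_eval_eq_zero (by omega) hcard hS hWS
  have hRdeg' : R.natDegree ≤ 9 := by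
    have : (H ^ 2 * D ^ 3 + W ^ 2).natDegree ≤ 2 * 2 ^ n + 9 := by
      refine natDegree_add_le_of_degree_le (natDegree_mul_le.trans ?_) ?_
      · have h1 := natDegree_pow_le_of_le 2 (show H.natDegree ≤ 2 ^ n by omega)
        have h2 := natDegree_pow_le_of_le 3 hD
        omega
      · have h1 := natDegree_pow_le_of_le 2 hWdeg
        omega
    omega
  have hfin : W ^ 2 * derivative D + R * D = 0 := by
    refine eq_zero_of_natDegree_lt_card_of_eval_eq_zero' _ S (fun s hs => ?_) ?_
    · have e1 := congrArg (fun p => eval s (derivative p)) hR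
      simp only [derivative_add, derivative_mul,
        derivative_X_pow_two_pow_add_X (show 1 ≤ n + 1 by omega), derivative_pow] at e1
      have e2 := hWS s hs
      have e3 := hS s hs
      simp at e1 e2 ⊢
      grind
    · have : (W ^ 2 * derivative D + R * D).natDegree ≤ 12 := by
        refine natDegree_add_le_of_degree_le (natDegree_mul_le.trans ?_)
          (natDegree_mul_le.trans ?_)
        · have h1 := natDegree_pow_le_of_le 2 hWdeg
          omega
        · omega
      omega
  have := congrArg (eval θ) hfin
  simpa [hW, hθ, hθ'] using this

end Stepanov

section Cubic

/-- If a root `x` of `x ^ 3 + a x + b` is fixed neither by the `2^m`-power Frobenius nor by its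
square, while `a` and `b` are fixed, then `a ^ 3 / b ^ 2` and `1` have the same absolute trace. -/
theorem absTrace_eq_of_cubic_root_frobenius {L : Type*} [Field L] [CharP L 2] {m : ℕ} {a b x : L}
    (ha : a ^ 2 ^ m = a) (hb : b ^ 2 ^ m = b) (hb0 : b ≠ 0) (hx : x ^ 3 + a * x + b = 0)
    (h1 : x ^ 2 ^ m ≠ x) (h2 : (x ^ 2 ^ m) ^ 2 ^ m ≠ x) :
    absTrace m (a ^ 3 / b ^ 2) = absTrace m 1 := by
  let φ : L →+* L := iterateFrobenius L 2 m
  have hφ : ∀ z, φ z = z ^ 2 ^ m := fun z => iterateFrobenius_def ..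
  simp only [← hφ] at ha hb h1 h2
  obtain ⟨y, hy⟩ : ∃ y, y = φ x := ⟨_, rfl⟩
  obtain ⟨z, hz⟩ : ∃ z, z = φ y := ⟨_, rfl⟩
  have hzy : z ≠ y := fun h' => h1 (φ.injective (by rw [← hy, ← hz, h']))
  have hzx : z ≠ x := by rwa [hz, hy]
  have hyx : y ≠ x := by rwa [hy]
  have hy3 : y ^ 3 + a * y + b = 0 := by
    simpa [ha, hb, hy] using congrArg φ hx
  have hz3 : z ^ 3 + a * z + b = 0 := by
    simpa [ha, hb, hz] using congrArg φ hy3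
  have ha' : a = x ^ 2 + x * y + y ^ 2 := by
    clear ha hb h1 h2 hφ hy hz hzy hzx hz3
    have : (x + y) * (a + (x ^ 2 + x * y + y ^ 2)) = 0 := by grind
    have := (mul_eq_zero.1 this).resolve_left fun h => hyx (CharTwo.add_eq_zero.1 h).symm
    exact CharTwo.add_eq_zero.1 this
  have hb' : b = x ^ 2 * y + x * y ^ 2 := by
    clear ha hb h1 h2 hφ hy hz hzy hzx hz3 hyx hy3
    grind
  have hz' : z = x + y := by
    clear ha hb h1 h2 hφ hy hz hyx hb0
    have : (z + x) * ((z + y) * (z + (x + y))) = 0 := by grind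
    have := (mul_eq_zero.1 this).resolve_left (mt CharTwo.add_eq_zero.1 hzx)
    have := (mul_eq_zero.1 this).resolve_left (mt CharTwo.add_eq_zero.1 hzy)
    exact CharTwo.add_eq_zero.1 this
  obtain ⟨r, hr⟩ : ∃ r, r = x ^ 3 + y ^ 3 + x ^ 2 * y := ⟨_, rfl⟩
  have hrφ : φ r = r := by
    simp only [hr, map_add, map_mul, map_pow, ← hy, ← hz, hz']
    clear * -
    grind
  have hsum : a ^ 3 / b ^ 2 + 1 = (r / b) ^ 2 + r / b := by
    field_simp
    rw [ha', hb', hr]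
    clear * -
    grind
  have e2 : (r / b) ^ 2 ^ m = r / b := by rw [← hφ, map_div₀, hrφ, hb]
  rw [← CharTwo.add_eq_zero, ← absTrace_add, hsum, absTrace_add, absTrace_sq e2,
    CharTwo.add_self_eq_zero]

/-- If `t ^ 3 + a t + b` has no root in the field `k` with `2^m` elements, then `a ^ 3 / b ^ 2` and
`1` have the same absolute trace. -/
theorem absTrace_eq_of_forall_cubic_ne_zero {k : Type*} [Field k] [Finite k] [CharP k 2] {m : ℕ}
    (hk : Nat.card k = 2 ^ m) {a b : k} (h : ∀ t : k, t ^ 3 + a * t + b ≠ 0) :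
    absTrace m (a ^ 3 / b ^ 2) = absTrace m 1 := by
  have hb : b ≠ 0 := by simpa using h 0
  have hfrob : ∀ x : k, x ^ 2 ^ m = x := fun x => by
    have := Fintype.ofFinite k
    rw [← hk, ← Fintype.card_eq_nat_card, FiniteField.pow_card]
  set g : k[X] := X ^ 3 + C a * X + C b with hg
  have hdeg : g.natDegree = 3 := by rw [hg]; compute_degree!
  have hirr : Irreducible g :=
    irreducible_of_degree_le_three_of_not_isRoot (by simp [hdeg])
      fun t ht => h t (by simpa [hg, IsRoot] using ht)
  have : Fact (Irreducible g) := ⟨hirr⟩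
  have : CharP (AdjoinRoot g) 2 :=
    charP_of_injective_algebraMap (algebraMap k (AdjoinRoot g)).injective 2
  set ι := AdjoinRoot.of g
  set x := AdjoinRoot.root g
  have hx : x ^ 3 + ι a * x + ι b = 0 := by
    have := AdjoinRoot.eval₂_root g
    simpa [hg] using this
  have hιfrob : ∀ c : k, ι c ^ 2 ^ m = ι c := fun c => by rw [← map_pow, hfrob]
  have hdvd : ∀ n : ℕ, x ^ (2 ^ m) ^ n = x ↔ 3 ∣ n := fun n => by
    have e1 := hirr.natDegree_dvd_iff_dvd_X_pow_card_pow_sub_X (n := n)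
    rw [hdeg, hk, ← AdjoinRoot.mk_eq_zero] at e1
    rw [e1, map_sub, map_pow, AdjoinRoot.mk_X, sub_eq_zero]
  have key := absTrace_eq_of_cubic_root_frobenius (hιfrob a) (hιfrob b) (by simpa using hb) hx
    (fun h' => by have := (hdvd 1).1 (by rw [pow_one, h']); omega)
    (fun h' => by have := (hdvd 2).1 (by rw [pow_two, pow_mul, h']); omega)
  apply ι.injective
  simpa [absTrace] using key

end Cubic

section CubicExtension

variable {K : Type*} [Field K] [Fintype K] [CharP K 2] {m : ℕ} {φ : K →+* K}

theorem card_filter_frobenius_eq [DecidableEq K] (hK : Fintype.card K = (2 ^ m) ^ 3) (hm : m ≠ 0) :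
    (Finset.univ.filter fun x : K => x ^ 2 ^ m = x).card = 2 ^ m := by
  have hlt : 1 < 2 ^ m := Nat.one_lt_two_pow hm
  have hsep : (X ^ 2 ^ m - X : K[X]).Separable :=
    galois_poly_separable 2 _ (dvd_pow_self 2 hm)
  have hne : (X ^ 2 ^ m - X : K[X]) ≠ 0 := FiniteField.X_pow_card_sub_X_ne_zero K hlt
  have hdvd : (X ^ 2 ^ m - X : K[X]) ∣ X ^ Fintype.card K - X := by
    rw [hK, ← pow_mul]
    exact dvd_pow_pow_sub_self_of_dvd (dvd_mul_right m 3)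
  have hne' : (X ^ Fintype.card K - X : K[X]) ≠ 0 :=
    FiniteField.X_pow_card_sub_X_ne_zero K Fintype.one_lt_card
  have hsplit : (X ^ Fintype.card K - X : K[X]).Splits := by
    rw [splits_iff_card_roots, FiniteField.roots_X_pow_card_sub_X,
      FiniteField.X_pow_card_sub_X_natDegree_eq K Fintype.one_lt_card]
    rfl
  have hcard := splits_iff_card_roots.1 (hsplit.of_dvd hne' hdvd)
  rw [FiniteField.X_pow_card_sub_X_natDegree_eq K hlt] at hcard
  refine Eq.trans ?_ hcard
  rw [← Multiset.toFinset_card_of_nodup (nodup_roots hsep)]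
  congr 1
  ext x
  simp [hne, sub_eq_zero]

theorem exists_trace_zero_pair (hK : Fintype.card K = (2 ^ m) ^ 3) (hm : m ≠ 0)
    (hφ : ∀ x, φ x = x ^ 2 ^ m) (h3 : ∀ x, φ (φ (φ x)) = x) :
    ∃ ρ₁ ρ₂ : K, ρ₂ ≠ 0 ∧ φ (φ ρ₁) = ρ₁ + φ ρ₁ ∧ φ (φ ρ₂) = ρ₂ + φ ρ₂ ∧
      ∀ s, φ s = s → ρ₁ ≠ s * ρ₂ := by
  classical
  have hlt : 1 < 2 ^ m := Nat.one_lt_two_pow hm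
  set S := Finset.univ.filter fun x : K => x ^ 2 ^ m = x
  have hS : S.card = 2 ^ m := card_filter_frobenius_eq hK hm
  have hmem : ∀ s, s ∈ S ↔ φ s = s := fun s => by simp [S, hφ]
  obtain ⟨w, hw⟩ : ∃ w, w ∉ S := by
    by_contra! h
    have := Finset.card_le_card (fun x _ => h x : Finset.univ ⊆ S)
    rw [Finset.card_univ, hK, hS] at this
    exact absurd this (not_le.2 (lt_self_pow₀ hlt (by norm_num)))
  obtain ⟨z, hz⟩ : ∃ z, z ∉ (S ×ˢ S).image fun p => p.1 + p.2 * w := by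
    by_contra! h
    have := (Finset.card_le_card (fun x _ => h x :
      Finset.univ ⊆ (S ×ˢ S).image fun p => p.1 + p.2 * w)).trans Finset.card_image_le
    rw [Finset.card_univ, hK, Finset.card_product, hS, ← pow_two] at this
    exact absurd this (not_le.2 (pow_lt_pow_right₀ hlt (by norm_num)))
  have htr : ∀ u, φ (φ (u + φ u)) = (u + φ u) + φ (u + φ u) := fun u => by
    simp only [map_add, h3]
    grind
  refine ⟨z + φ z, w + φ w, ?_, htr z, htr w, fun s hs h => hz ?_⟩
  · rw [hmem] at hw
    rwa [Ne, CharTwo.add_eq_zero, eq_comm]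
  · refine Finset.mem_image.2 ⟨(z + s * w, s), Finset.mem_product.2 ⟨(hmem _).2 ?_, (hmem _).2 hs⟩, ?_⟩
    · rw [map_add, map_mul, hs]
      clear * - h
      grind
    · clear * -
      grind

theorem absTrace_eq_of_forall_fixed_cubic_ne_zero (hK : Fintype.card K = (2 ^ m) ^ 3) (hm : m ≠ 0)
    (hφ : ∀ x, φ x = x ^ 2 ^ m) {a b : K} (ha : φ a = a) (hb : φ b = b)
    (h : ∀ t, φ t = t → t ^ 3 + a * t + b ≠ 0) :
    absTrace m (a ^ 3 / b ^ 2) = absTrace m 1 := by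
  classical
  let k := φ.eqLocusField (RingHom.id K)
  have hk : Nat.card k = 2 ^ m := by
    rw [← card_filter_frobenius_eq hK hm]
    exact Nat.subtype_card _ fun x => by
      change _ ↔ φ x = x
      simp [hφ]
  have key := absTrace_eq_of_forall_cubic_ne_zero hk (a := ⟨a, ha⟩) (b := ⟨b, hb⟩)
    fun t ht => h t t.2 (by simpa using congrArg Subtype.val ht)
  simpa [absTrace] using congrArg Subtype.val key

end CubicExtension

section NormTrace

variable {K : Type*} [Field K] [CharP K 2] {m : ℕ} {φ : K →+* K}

/-- The identity behind the trace condition for the cubic with coefficients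
`g ^ 2 (Q + ℓ ^ 2)` and `g ^ 2 N`. -/
theorem cubic_invariant_eq (g x y α β : K) (hN : x ^ 2 * y + x * y ^ 2 ≠ 0) (hg : g ≠ 0) :
    (g ^ 2 * (x ^ 2 + x * y + y ^ 2 + (α * x + β * y) ^ 2)) ^ 3 /
      (g ^ 2 * (x ^ 2 * y + x * y ^ 2)) ^ 2 =
    (g * (x ^ 3 + y ^ 3 + x ^ 2 * y) / (x ^ 2 * y + x * y ^ 2)) ^ 2 +
    g ^ 2 * (x ^ 3 + y ^ 3 + x ^ 2 * y) / (x ^ 2 * y + x * y ^ 2) + g ^ 2 +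
    (g * ((x ^ 2 + x * y + y ^ 2) * (α * x + β * y) + (α * x + β * y) ^ 3 +
      (β ^ 2 * (x * y ^ 2 + y ^ 3) + α ^ 2 * (x ^ 3 + x * y ^ 2) + (α ^ 2 + β ^ 2) * x ^ 2 * y)) /
      (x ^ 2 * y + x * y ^ 2)) ^ 2 +
    g ^ 2 * ((x ^ 2 + x * y + y ^ 2) * (α ^ 4 * x + β ^ 4 * y)) / (x ^ 2 * y + x * y ^ 2) := by
  generalize hn : x ^ 2 * y + x * y ^ 2 = n at hN
  field_simp
  subst hn
  clear * -
  grind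

/-- For `x` of trace zero over the fixed field of `φ`, written `α`, `β` for the coefficients of the
linear form `ℓ = α x + β y`, the trace of the invariant of the associated cubic, with squares
replaced by their roots. -/
theorem absTrace_div_eq (hφ : ∀ x, φ x = x ^ 2 ^ m) {g x y α β : K}
    (hN : x ^ 2 * y + x * y ^ 2 ≠ 0) (hg : g ≠ 0) (hφg : φ g = g) (hx : φ x = y)
    (hy : φ y = x + y) (hα : φ α = α + β) (hβ : φ β = α) :
    absTrace m (((g + g ^ 2) * (x ^ 3 + y ^ 3 + x ^ 2 * y) +
        g * ((x ^ 2 + x * y + y ^ 2) * (α * x + β * y) + (α * x + β * y) ^ 3 +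
          (β ^ 2 * (x * y ^ 2 + y ^ 3) + α ^ 2 * (x ^ 3 + x * y ^ 2) +
            (α ^ 2 + β ^ 2) * x ^ 2 * y)) +
        g ^ 2 * ((x ^ 2 + x * y + y ^ 2) * (α ^ 4 * x + β ^ 4 * y))) /
        (x ^ 2 * y + x * y ^ 2)) =
      absTrace m ((g ^ 2 * (x ^ 2 + x * y + y ^ 2 + (α * x + β * y) ^ 2)) ^ 3 /
        (g ^ 2 * (x ^ 2 * y + x * y ^ 2)) ^ 2) + absTrace m g := by
  have hXφ : (g * (x ^ 3 + y ^ 3 + x ^ 2 * y) / (x ^ 2 * y + x * y ^ 2)) ^ 2 ^ m =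
      g * (x ^ 3 + y ^ 3 + x ^ 2 * y) / (x ^ 2 * y + x * y ^ 2) := by
    rw [← hφ]
    simp only [map_div₀, map_mul, map_add, map_pow, hφg, hx, hy]
    clear * -
    congr 1 <;> grind
  have hWφ : (g * ((x ^ 2 + x * y + y ^ 2) * (α * x + β * y) + (α * x + β * y) ^ 3 +
      (β ^ 2 * (x * y ^ 2 + y ^ 3) + α ^ 2 * (x ^ 3 + x * y ^ 2) + (α ^ 2 + β ^ 2) * x ^ 2 * y)) /
      (x ^ 2 * y + x * y ^ 2)) ^ 2 ^ m =
      g * ((x ^ 2 + x * y + y ^ 2) * (α * x + β * y) + (α * x + β * y) ^ 3 +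
      (β ^ 2 * (x * y ^ 2 + y ^ 3) + α ^ 2 * (x ^ 3 + x * y ^ 2) + (α ^ 2 + β ^ 2) * x ^ 2 * y)) /
      (x ^ 2 * y + x * y ^ 2) := by
    rw [← hφ]
    simp only [map_div₀, map_mul, map_add, map_pow, hφg, hx, hy, hα, hβ]
    clear * -
    congr 1 <;> grind
  have hgφ : g ^ 2 ^ m = g := by rw [← hφ, hφg]
  rw [cubic_invariant_eq g x y α β hN hg, add_mul g (g ^ 2)]
  simp only [absTrace_add, absTrace_sq hXφ, absTrace_sq hWφ, absTrace_sq hgφ, add_div]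
  clear * -
  grind

/-- The polynomial form of `absTrace_div_eq` along the line `x = ρ₁ + s ρ₂`: a constant trace
forces the linear form to satisfy a polynomial identity. -/
theorem eq_zero_of_absTrace_line_eq_const [Fintype K] (hK : Fintype.card K = (2 ^ m) ^ 3)
    (hm : 4 ≤ m) (hφ : ∀ x, φ x = x ^ 2 ^ m) (h3 : ∀ x, φ (φ (φ x)) = x) {g α β c : K}
    (h : ∀ x : K, x ≠ 0 → φ (φ x) = x + φ x →
      absTrace m (((g + g ^ 2) * (x ^ 3 + φ x ^ 3 + x ^ 2 * φ x) +
        g * ((x ^ 2 + x * φ x + φ x ^ 2) * (α * x + β * φ x) + (α * x + β * φ x) ^ 3 +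
          (β ^ 2 * (x * φ x ^ 2 + φ x ^ 3) + α ^ 2 * (x ^ 3 + x * φ x ^ 2) +
            (α ^ 2 + β ^ 2) * x ^ 2 * φ x)) +
        g ^ 2 * ((x ^ 2 + x * φ x + φ x ^ 2) * (α ^ 4 * x + β ^ 4 * φ x))) /
        (x ^ 2 * φ x + x * φ x ^ 2)) = c) :
    (g + g ^ 2) + g * (β + β ^ 3 + β ^ 2) + g ^ 2 * β ^ 4 = 0 := by
  classical
  have hm0 : m ≠ 0 := by omega
  obtain ⟨ρ₁, ρ₂, hρ₂, ht₁, ht₂, hindep⟩ := exists_trace_zero_pair hK hm0 hφ h3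
  set S := Finset.univ.filter fun x : K => x ^ 2 ^ m = x
  have hmem : ∀ s, s ∈ S ↔ φ s = s := fun s => by simp [S, hφ]
  let x : K[X] := C ρ₁ + C ρ₂ * X
  let y : K[X] := C (φ ρ₁) + C (φ ρ₂) * X
  let P : K[X] := C (g + g ^ 2) * (x ^ 3 + y ^ 3 + x ^ 2 * y) +
        C g * ((x ^ 2 + x * y + y ^ 2) * (C α * x + C β * y) + (C α * x + C β * y) ^ 3 +
          (C β ^ 2 * (x * y ^ 2 + y ^ 3) + C α ^ 2 * (x ^ 3 + x * y ^ 2) +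
            C (α ^ 2 + β ^ 2) * x ^ 2 * y)) +
        C g ^ 2 * ((x ^ 2 + x * y + y ^ 2) * (C α ^ 4 * x + C β ^ 4 * y))
  let D : K[X] := x ^ 2 * y + x * y ^ 2
  have hP : P.natDegree ≤ 3 := by
    simp only [P, x, y]
    compute_degree
  have hD : D.natDegree ≤ 3 := by
    simp only [D, x, y]
    compute_degree
  have hx : ∀ s, x.eval s = ρ₁ + ρ₂ * s := fun s => by simp [x]
  have hy : ∀ s, φ s = s → y.eval s = φ (ρ₁ + ρ₂ * s) := fun s hs => by simp [y, hs]
  have hx0 : ∀ s, φ s = s → ρ₁ + ρ₂ * s ≠ 0 := fun s hs h0 => by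
    rw [CharTwo.add_eq_zero, mul_comm] at h0
    exact hindep s hs h0
  have htr : ∀ s, φ s = s → φ (φ (ρ₁ + ρ₂ * s)) = (ρ₁ + ρ₂ * s) + φ (ρ₁ + ρ₂ * s) :=
    fun s hs => by
      simp only [map_add, map_mul, hs, ht₁, ht₂]
      ring
  have hDeval : ∀ s, φ s = s → D.eval s = (ρ₁ + ρ₂ * s) * φ (ρ₁ + ρ₂ * s) *
      φ (φ (ρ₁ + ρ₂ * s)) := fun s hs => by
    rw [htr s hs]
    simp only [D, eval_add, eval_mul, eval_pow, hx, hy s hs]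
    ring
  obtain ⟨θ, hθ⟩ : ∃ θ, ρ₁ = ρ₂ * θ := ⟨ρ₁ / ρ₂, by field_simp⟩
  have hxθ : x.eval θ = 0 := by rw [hx, hθ, CharTwo.add_self_eq_zero]
  have hyθ : y.eval θ ≠ 0 := by
    simp only [y, hθ, eval_add, eval_mul, eval_C, eval_X, map_mul]
    rw [← mul_add]
    refine mul_ne_zero (by simpa using hρ₂) fun h0 => ?_
    exact hindep θ (CharTwo.add_eq_zero.1 h0) (by rw [hθ, mul_comm])
  have key := eval_eq_zero_of_absTrace_eq_const (P := P) (D := D) (θ := θ) (c := c) hm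
    (card_filter_frobenius_eq hK hm0) (fun s hs => by rw [← hφ, (hmem s).1 hs]) hP hD
    (fun s hs => by
      have hs := (hmem s).1 hs
      rw [hDeval s hs]
      exact mul_ne_zero (mul_ne_zero (hx0 s hs) ((map_ne_zero φ).2 (hx0 s hs)))
        ((map_ne_zero φ).2 ((map_ne_zero φ).2 (hx0 s hs))))
    (fun s hs => by
      have hs := (hmem s).1 hs
      rw [hDeval s hs, ← hφ]
      simp only [map_mul, h3]
      ring)
    (fun s hs => by
      have hs := (hmem s).1 hs
      rw [← h _ (hx0 s hs) (htr s hs)]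
      simp only [P, D, eval_add, eval_mul, eval_pow, eval_C, hx, hy s hs])
    (by simp [D, hxθ])
    (by
      have : (derivative D).eval θ = ρ₂ * y.eval θ ^ 2 := by
        have hx' : derivative x = C ρ₂ := by simp [x]
        simp [D, hxθ, hx', derivative_pow]
      rw [this]
      exact mul_ne_zero hρ₂ (pow_ne_zero 2 hyθ))
  have : y.eval θ ^ 3 * ((g + g ^ 2) + g * (β + β ^ 3 + β ^ 2) + g ^ 2 * β ^ 4) = 0 := by
    rw [← key]
    simp only [P, eval_add, eval_mul, eval_pow, eval_C, hxθ]
    ring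
  exact (mul_eq_zero.1 this).resolve_left (pow_ne_zero 3 hyθ)

/-- Over a cubic extension of the field with `2^m` elements, some nonzero `r` satisfies
`N(r) = Tr(δ r) ^ 2 Tr(r)`. -/
theorem exists_norm_eq_trace_sq_mul_trace [Fintype K] (hK : Fintype.card K = (2 ^ m) ^ 3)
    (hm : 4 ≤ m) (hφ : ∀ x, φ x = x ^ 2 ^ m) (h3 : ∀ x, φ (φ (φ x)) = x) {δ : K} (hδ : δ ≠ 0) :
    ∃ r : K, r ≠ 0 ∧ r * φ r * φ (φ r) =
      (δ * r + φ δ * φ r + φ (φ δ) * φ (φ r)) ^ 2 * (r + φ r + φ (φ r)) := by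
  by_contra! hcon
  have hm0 : m ≠ 0 := by omega
  obtain ⟨τ, hτ⟩ : ∃ τ, τ = δ + φ δ + φ (φ δ) := ⟨_, rfl⟩
  obtain ⟨α, hα⟩ : ∃ α, α = φ (φ δ) + δ := ⟨_, rfl⟩
  obtain ⟨β, hβ⟩ : ∃ β, β = φ δ + φ (φ δ) := ⟨_, rfl⟩
  have hφτ : φ τ = τ := by
    simp only [hτ, map_add, h3]
    ring
  have hφα : φ α = α + β := by
    simp only [hα, hβ, map_add, h3]
    clear * -
    grind
  have hφβ : φ β = α := by simp only [hα, hβ, map_add, h3]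
  have hτ1 : 1 + τ ≠ 0 := fun h0 => by
    have := hcon 1 one_ne_zero
    simp only [map_one, mul_one, ← hτ, ← CharTwo.add_eq_zero.1 h0] at this
    clear * - this
    grind
  obtain ⟨g, hg⟩ : ∃ g, g = (1 + τ)⁻¹ := ⟨_, rfl⟩
  have hg0 : g ≠ 0 := by rw [hg]; exact inv_ne_zero hτ1
  have hgτ : g * (1 + τ) = 1 := by rw [hg]; exact inv_mul_cancel₀ hτ1
  have hφg : φ g = g := by rw [hg, map_inv₀, map_add, map_one, hφτ]
  have hpoly := eq_zero_of_absTrace_line_eq_const (g := g) (α := α) (β := β)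
    (c := absTrace m 1 + absTrace m g) hK hm hφ h3 fun x hx0 hx => by
    obtain ⟨y, hy⟩ : ∃ y, y = φ x := ⟨_, rfl⟩
    rw [← hy] at hx ⊢
    have hy0 : y ≠ 0 := by rw [hy]; simpa using hx0
    have hxy0 : x + y ≠ 0 := by rw [← hx]; simpa using hy0
    have hN : x ^ 2 * y + x * y ^ 2 ≠ 0 := by
      have : x ^ 2 * y + x * y ^ 2 = x * y * (x + y) := by ring
      rw [this]
      exact mul_ne_zero (mul_ne_zero hx0 hy0) hxy0
    rw [absTrace_div_eq hφ hN hg0 hφg hy.symm hx hφα hφβ]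
    congr 1
    refine absTrace_eq_of_forall_fixed_cubic_ne_zero hK hm0 hφ ?_ ?_ fun t ht h0 => ?_
    · simp only [map_mul, map_add, map_pow, hφg, ← hy, hx, hφα, hφβ]
      clear * -
      grind
    · simp only [map_mul, map_add, map_pow, hφg, ← hy, hx]
      clear * -
      grind
    · have hr0 : t + x ≠ 0 := fun h0 => by
        rw [CharTwo.add_eq_zero] at h0
        apply hxy0
        rw [hy, ← h0, ht, CharTwo.add_self_eq_zero]
      apply hcon (t + x) hr0
      simp only [map_add, ht, ← hy, hx]
      clear hcon hφ h3 hK hφτ hφα hφβ hφg ht hy hx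
      have hfac : g ^ 2 * ((t + x) * (t + y) * (t + (x + y)) +
          (δ * (t + x) + φ δ * (t + y) + φ (φ δ) * (t + (x + y))) ^ 2 *
            (t + x + (t + y) + (t + (x + y)))) = 0 := by
        generalize φ (φ δ) = δ₂ at *
        generalize φ δ = δ₁ at *
        rw [← h0]
        grind
      exact CharTwo.add_eq_zero.1 ((mul_eq_zero.1 hfac).resolve_left (pow_ne_zero 2 hg0))
  have hprod : (1 + β) ^ 3 * (1 + g * (1 + β)) = 0 := by
    have : g * ((1 + β) ^ 3 * (1 + g * (1 + β))) = 0 := by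
      clear hcon hφ h3 hK hφτ hφα hφβ hφg
      grind
    exact (mul_eq_zero.1 this).resolve_left hg0
  have hφβ' : φ β = β := by
    rcases mul_eq_zero.1 hprod with h0 | h0
    · rw [← CharTwo.add_eq_zero.1 (pow_eq_zero_iff (by norm_num) |>.1 h0), map_one]
    · have : β = g⁻¹ + 1 := by
        clear hcon hφ h3 hK hφτ hφα hφβ hφg
        field_simp
        grind
      rw [this, map_add, map_inv₀, hφg, map_one]
  have hαβ : α = β := by rw [← hφβ, hφβ']
  have hβ0 : β = 0 := by
    rw [hαβ, hφβ', CharTwo.add_self_eq_zero] at hφα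
    exact hφα
  have hδφ : φ δ = δ := by
    refine (φ.injective ?_).symm
    exact CharTwo.add_eq_zero.1 (hβ.symm.trans hβ0)
  have hτδ : τ = δ := by rw [hτ, hδφ, hδφ, CharTwo.add_self_eq_zero, zero_add]
  have hg1 : 1 + g = 0 := by
    refine (mul_eq_zero.1 (?_ : g * (1 + g) = 0)).resolve_left hg0
    rw [← hpoly, hβ0]
    ring
  rw [← CharTwo.add_eq_zero.1 hg1, one_mul, add_eq_left, hτδ] at hgτ
  exact hδ hgτ

end NormTrace

section Reduction

variable {K : Type*} [Field K] {φ : K →+* K}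

theorem exists_linear_comb_frobenius_ne_zero (h3 : ∀ x, φ (φ (φ x)) = x) (hφ1 : ∃ w, φ w ≠ w)
    {v : Fin 3 → K} (hv : v ≠ 0) : ∃ x, v 0 * x + v 1 * φ x + v 2 * φ (φ x) ≠ 0 := by
  by_contra! h
  obtain ⟨w, hw⟩ := hφ1
  have hinj : Function.Injective
      ![MonoidHom.id K, (φ : K →* K), (φ.comp φ : K →+* K)] := by
    have h01 : MonoidHom.id K ≠ (φ : K →* K) := fun h' => hw (DFunLike.congr_fun h' w).symm
    have h02 : MonoidHom.id K ≠ (φ.comp φ : K →+* K) := fun h' => hw <| by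
      have : w = φ (φ w) := DFunLike.congr_fun h' w
      conv_rhs => rw [← h3 w, ← this]
    have h12 : (φ : K →* K) ≠ (φ.comp φ : K →+* K) := fun h' => hw <| by
      have : φ w = φ (φ w) := DFunLike.congr_fun h' w
      exact (φ.injective this).symm
    intro i j hij
    fin_cases i <;> fin_cases j <;>
      first | rfl | exact absurd hij ‹_› | exact absurd hij.symm ‹_›
  have hli := (linearIndependent_monoidHom K K).comp _ hinj
  refine hv (funext (Fintype.linearIndependent_iff.1 hli v ?_))
  ext x
  simpa [Fin.sum_univ_three] using h x

variable [CharP K 2]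

/-- A twisted-linear equation in a cubic extension has a nonzero solution iff its Dickson
determinant vanishes. -/
theorem exists_ne_zero_iff_dickson_eq_zero (h3 : ∀ x, φ (φ (φ x)) = x) (hφ1 : ∃ w, φ w ≠ w)
    (A B r : K) :
    (∃ a, a ≠ 0 ∧ φ a + A * a * r + B * φ (φ a) * φ r = 0) ↔
      (A * φ A * φ (φ A) + B * φ B * φ (φ B)) * (r * φ r * φ (φ r)) + 1 +
        (A * φ (φ B) * r ^ 2 + φ A * B * φ r ^ 2 + φ (φ A) * φ B * φ (φ r) ^ 2) = 0 := by
  let M : Matrix (Fin 3) (Fin 3) K :=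
    !![A * r, 1, B * φ r; φ B * φ (φ r), φ A * φ r, 1; 1, φ (φ B) * r, φ (φ A) * φ (φ r)]
  have hdet : M.det = (A * φ A * φ (φ A) + B * φ B * φ (φ B)) * (r * φ r * φ (φ r)) + 1 +
        (A * φ (φ B) * r ^ 2 + φ A * B * φ r ^ 2 + φ (φ A) * φ B * φ (φ r) ^ 2) := by
    simp only [M, Matrix.det_fin_three]
    simp
    clear * -
    grind
  have hM : ∀ v, M.mulVec v = 0 ↔ A * r * v 0 + v 1 + B * φ r * v 2 = 0 ∧
      φ B * φ (φ r) * v 0 + φ A * φ r * v 1 + v 2 = 0 ∧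
      v 0 + φ (φ B) * r * v 1 + φ (φ A) * φ (φ r) * v 2 = 0 := fun v => by
    simp [M, funext_iff, Fin.forall_fin_succ, dotProduct, Fin.sum_univ_three]
  rw [← hdet, ← Matrix.exists_mulVec_eq_zero_iff]
  constructor
  · rintro ⟨a, ha, h⟩
    refine ⟨![a, φ a, φ (φ a)], fun h0 => ha (by simpa using congrFun h0 0), (hM _).2 ?_⟩
    have h' := congrArg φ h
    have h'' := congrArg φ h'
    simp only [map_add, map_mul, map_zero, h3] at h' h''
    simp only [Matrix.cons_val_zero, Matrix.cons_val_one, Matrix.cons_val]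
    exact ⟨by linear_combination h, by linear_combination h', by linear_combination h''⟩
  · rintro ⟨v, hv, h⟩
    obtain ⟨e1, e2, e3⟩ := (hM v).1 h
    have hv' : ![v 0, φ (v 2), φ (φ (v 1))] ≠ 0 := fun h0 => hv <| by
      have h1 := congrFun h0 0
      have h2 := congrFun h0 1
      have h3 := congrFun h0 2
      simp at h1 h2 h3
      ext i
      fin_cases i <;> simp [*]
    obtain ⟨x, hx⟩ := exists_linear_comb_frobenius_ne_zero h3 hφ1 hv'
    refine ⟨_, hx, ?_⟩
    replace e2 := congrArg φ (congrArg φ e2)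
    replace e3 := congrArg φ e3
    simp only [map_add, map_mul, map_zero, h3] at e2 e3
    simp only [Matrix.cons_val_zero, Matrix.cons_val_one, Matrix.cons_val, map_add, map_mul, h3]
    linear_combination x * e1 + φ x * e3 + φ (φ x) * e2

/-- The quadratic map `u ↦ φ(u)(φ(u) + A u + B φ²(u))` is injective iff a Dickson determinant does
not vanish on the elements of trace `1`. -/
theorem injective_quadratic_iff (h3 : ∀ x, φ (φ (φ x)) = x) (hφ1 : ∃ w, φ w ≠ w) (A B : K) :
    (Function.Injective fun u => φ u * (φ u + A * u + B * φ (φ u))) ↔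
      ∀ r, r + φ r + φ (φ r) = 1 →
        (A * φ A * φ (φ A) + B * φ B * φ (φ B)) * (r * φ r * φ (φ r)) + 1 +
        (A * φ (φ B) * r ^ 2 + φ A * B * φ r ^ 2 + φ (φ A) * φ B * φ (φ r) ^ 2) ≠ 0 := by
  have hdiff : ∀ a t, φ (a * t + a) * (φ (a * t + a) + A * (a * t + a) + B * φ (φ (a * t + a))) +
      φ (a * t) * (φ (a * t) + A * (a * t) + B * φ (φ (a * t))) =
      φ a * (φ a + A * a * (t + φ t + 1) + B * φ (φ a) * φ (t + φ t + 1)) := fun a t => by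
    simp only [map_add, map_mul, map_one]
    clear * -
    grind
  constructor
  · intro hinj r hr hdet
    obtain ⟨a, ha, h⟩ := (exists_ne_zero_iff_dickson_eq_zero h3 hφ1 A B r).2 hdet
    have hr' : φ r + 1 + φ (φ r + 1) + 1 = r := by
      simp only [map_add, map_one]
      clear * - hr
      grind
    have := hdiff a (φ r + 1)
    rw [hr', h, mul_zero] at this
    have := hinj (CharTwo.add_eq_zero.1 this)
    exact ha (by simpa using this)
  · intro H u w huw
    by_contra hne
    obtain ⟨a, ha⟩ : ∃ a, a = w + u := ⟨_, rfl⟩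
    have ha0 : a ≠ 0 := fun h0 => hne (CharTwo.add_eq_zero.1 (ha.symm.trans h0)).symm
    obtain ⟨t, ht⟩ : ∃ t, u = a * t := ⟨u / a, by field_simp⟩
    have hw : w = a * t + a := by
      rw [← ht, ha]
      clear * -
      grind
    have hd := hdiff a t
    rw [← hw, ← ht] at hd
    have huw' := CharTwo.add_eq_zero.2 huw.symm
    rw [huw', eq_comm] at hd
    have hE := (mul_eq_zero.1 hd).resolve_left (by simpa using ha0)
    refine H (t + φ t + 1) ?_ ((exists_ne_zero_iff_dickson_eq_zero h3 hφ1 A B _).1 ⟨a, ha0, hE⟩)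
    simp only [map_add, map_one, h3]
    clear * -
    grind

/-- The substitution `x = φ(u) φ²(u)` turns the rational form of the permutation into a quadratic
map. -/
theorem bijective_iff_injective_quadratic [Finite K] (h3 : ∀ x, φ (φ (φ x)) = x) (A B : K) :
    (Function.Bijective fun x => φ (φ x) * x / φ x + A * φ (φ x) + B * x) ↔
      Function.Injective fun u => φ u * (φ u + A * u + B * φ (φ u)) := by
  have hψ : Function.Injective fun u => φ u * φ (φ u) := fun u w h => by
    have h' := congrArg φ h
    have h'' := congrArg φ h'
    simp only [map_mul, h3] at h h' h''
    rcases eq_or_ne u 0 with rfl | hu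
    · simp_all
    · have hu1 : φ u ≠ 0 := by simpa using hu
      have hu2 : φ (φ u) ≠ 0 := by simpa using hu1
      have : (φ u * φ (φ u)) * u ^ 2 = (φ u * φ (φ u)) * w ^ 2 := by
        linear_combination (φ (φ u) * u) * h'' + (w * φ w) * h' - w ^ 2 * h
      exact CharTwo.sq_injective (mul_left_cancel₀ (mul_ne_zero hu1 hu2) this)
  have hψ' : Function.Bijective fun u => φ u * φ (φ u) := Finite.injective_iff_bijective.1 hψ
  have hcomp : (fun u => φ u * (φ u + A * u + B * φ (φ u))) =
      (fun x => φ (φ x) * x / φ x + A * φ (φ x) + B * x) ∘ fun u => φ u * φ (φ u) := by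
    ext u
    simp only [Function.comp, map_mul, h3]
    rcases eq_or_ne u 0 with rfl | hu
    · simp
    · have hu2 : φ (φ u) ≠ 0 := by simpa using hu
      field_simp
  rw [hcomp, Function.Injective.of_comp_iff' _ hψ', Finite.injective_iff_bijective]

end Reduction

section Criterion

variable {K : Type*} [Field K] [CharP K 2] {φ : K →+* K}

theorem dickson_ne_zero_of_norm_eq {A B : K} (h3 : ∀ x, φ (φ (φ x)) = x)
    (hN : A * φ A * φ (φ A) = B * φ B * φ (φ B)) (hg : φ (φ A * B) = φ A * B)
    (hg1 : φ A * B ≠ 1) {r : K} (hr : r + φ r + φ (φ r) = 1) :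
    (A * φ A * φ (φ A) + B * φ B * φ (φ B)) * (r * φ r * φ (φ r)) + 1 +
      (A * φ (φ B) * r ^ 2 + φ A * B * φ r ^ 2 + φ (φ A) * φ B * φ (φ r) ^ 2) ≠ 0 := by
  have hg2 : A * φ (φ B) = φ A * B := by
    have : φ (φ (φ A * B)) = φ A * B := by rw [hg, hg]
    simpa [h3] using this
  rw [map_mul] at hg
  rw [hN, hg2, hg]
  intro h
  apply hg1
  have : (r + φ r + φ (φ r)) ^ 2 = 1 := by rw [hr, one_pow]
  clear hN hg hg2 hg1 h3
  grind

theorem dickson_ne_zero_of_eq_one {A B : K} (h3 : ∀ x, φ (φ (φ x)) = x)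
    (hg : φ A * B = 1) (hB1 : B * φ B * φ (φ B) ≠ 1) {r : K} (hr : r + φ r + φ (φ r) = 1) :
    (A * φ A * φ (φ A) + B * φ B * φ (φ B)) * (r * φ r * φ (φ r)) + 1 +
      (A * φ (φ B) * r ^ 2 + φ A * B * φ r ^ 2 + φ (φ A) * φ B * φ (φ r) ^ 2) ≠ 0 := by
  have hg' : φ (φ A) * φ B = 1 := by rw [← map_mul, hg, map_one]
  have hg'' : A * φ (φ B) = 1 := by simpa [h3] using congrArg φ hg'
  have hr0 : r ≠ 0 := fun h0 => by simp [h0] at hr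
  have he : A * φ A * φ (φ A) + B * φ B * φ (φ B) ≠ 0 := fun he => by
    apply hB1
    apply CharTwo.sq_injective
    have := CharTwo.add_eq_zero.1 he
    simp only [one_pow]
    linear_combination (-(B * φ B * φ (φ B))) * this + hg * (φ (φ A) * φ B) * (A * φ (φ B)) +
      hg' * (A * φ (φ B)) + hg''
  rw [hg, hg', hg'']
  have : (r + φ r + φ (φ r)) ^ 2 = 1 := by rw [hr, one_pow]
  have key : (A * φ A * φ (φ A) + B * φ B * φ (φ B)) * (r * φ r * φ (φ r)) + 1 +
      (1 * r ^ 2 + 1 * φ r ^ 2 + 1 * φ (φ r) ^ 2) =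
      (A * φ A * φ (φ A) + B * φ B * φ (φ B)) * (r * φ r * φ (φ r)) := by
    clear hg hg' hg'' hB1 he h3 hr
    generalize (A * φ A * φ (φ A) + B * φ B * φ (φ B)) * (r * φ r * φ (φ r)) = t
    grind
  rw [key]
  exact mul_ne_zero he (by simpa using hr0)

theorem exists_dickson_eq_zero_of_norm_eq [Finite K] {A B : K} (h3 : ∀ x, φ (φ (φ x)) = x)
    (hN : A * φ A * φ (φ A) = B * φ B * φ (φ B)) (hg : φ (φ A * B) ≠ φ A * B) :
    ∃ r, r + φ r + φ (φ r) = 1 ∧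
      (A * φ A * φ (φ A) + B * φ B * φ (φ B)) * (r * φ r * φ (φ r)) + 1 +
      (A * φ (φ B) * r ^ 2 + φ A * B * φ r ^ 2 + φ (φ A) * φ B * φ (φ r) ^ 2) = 0 := by
  obtain ⟨d, hd⟩ : ∃ d, d = A * φ (φ B) + 1 := ⟨_, rfl⟩
  have hdφ : φ d = φ A * B + 1 := by simp [hd, h3]
  have hd0 : d ≠ 0 := fun h0 => hg <| by
    rw [h0, map_zero, eq_comm, CharTwo.add_eq_zero] at hdφ
    rw [hdφ, map_one]
  have hdd : φ (φ d) ≠ d := fun h0 => hg <| by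
    have h1 : φ (φ d) = φ d := by
      rw [h0]
      conv_rhs => rw [← h0, h3]
    rw [hdφ, map_add, map_one] at h1
    exact add_right_cancel h1
  obtain ⟨d₁, hd₁⟩ : ∃ d₁, d₁ = φ d := ⟨_, rfl⟩
  obtain ⟨d₂, hd₂⟩ : ∃ d₂, d₂ = φ d₁ := ⟨_, rfl⟩
  have hd₂' : φ d₂ = d := by rw [hd₂, hd₁, h3]
  have hd₁0 : d₁ ≠ 0 := by simpa [hd₁] using hd0
  have hd₂0 : d₂ ≠ 0 := by simpa [hd₂] using hd₁0
  have hc : d⁻¹ + d₂⁻¹ ≠ 0 := by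
    rw [Ne, CharTwo.add_eq_zero, inv_inj, hd₂, hd₁, eq_comm]
    exact hdd
  obtain ⟨z, hz⟩ : ∃ z, z * (d⁻¹ + d₂⁻¹) = 1 := ⟨_, inv_mul_cancel₀ hc⟩
  obtain ⟨r, hr⟩ : IsSquare ((z + φ z) * d⁻¹) :=
    FiniteField.isSquare_of_char_two (ringChar.eq K 2) _
  have hz' := congrArg φ hz
  have hz'' := congrArg φ hz'
  have hr' := congrArg φ hr
  have hr'' := congrArg φ hr'
  simp only [map_mul, map_add, map_one, map_inv₀, ← hd₁, ← hd₂, hd₂', h3] at hz' hz'' hr' hr''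
  have htr : (r + φ r + φ (φ r)) ^ 2 = 1 := by
    clear hN hg hd hdφ hd0 hdd hd₁ hd₂ hd₂' hc h3
    grind
  refine ⟨r, CharTwo.sq_injective (by simpa using htr), ?_⟩
  rw [hN, CharTwo.add_self_eq_zero]
  have e0 : A * φ (φ B) = d + 1 := by rw [hd]; clear * -; grind
  have e1 : φ A * B = d₁ + 1 := by rw [hd₁, hdφ]; clear * -; grind
  have e2 : φ (φ A) * φ B = d₂ + 1 := by rw [hd₂, hd₁, hdφ]; simp; clear * -; grind
  rw [e0, e1, e2]
  have f0 : d * r ^ 2 = z + φ z := by rw [pow_two, ← hr]; field_simp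
  have f1 : d₁ * φ r ^ 2 = φ z + φ (φ z) := by rw [pow_two, ← hr']; field_simp
  have f2 : d₂ * φ (φ r) ^ 2 = φ (φ z) + z := by rw [pow_two, ← hr'']; field_simp
  clear hN hg hd hdφ hd0 hdd hd₁ hd₂ hd₂' hc h3 hz hz' hz'' hr hr' hr'' e0 e1 e2
  grind

theorem exists_dickson_eq_zero_of_norm_ne [Fintype K] {m : ℕ}
    (hK : Fintype.card K = (2 ^ m) ^ 3) (hm : 4 ≤ m) (hφ : ∀ x, φ x = x ^ 2 ^ m) {A B : K}
    (h3 : ∀ x, φ (φ (φ x)) = x) (hN : A * φ A * φ (φ A) ≠ B * φ B * φ (φ B))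
    (hg : φ A * B ≠ 1) :
    ∃ r, r + φ r + φ (φ r) = 1 ∧
      (A * φ A * φ (φ A) + B * φ B * φ (φ B)) * (r * φ r * φ (φ r)) + 1 +
      (A * φ (φ B) * r ^ 2 + φ A * B * φ r ^ 2 + φ (φ A) * φ B * φ (φ r) ^ 2) = 0 := by
  have hchar : ringChar K = 2 := (ringChar.eq K 2)
  obtain ⟨ε, hε⟩ : IsSquare (A * φ A * φ (φ A) + B * φ B * φ (φ B)) :=
    FiniteField.isSquare_of_char_two hchar _
  obtain ⟨δ, hδ⟩ : IsSquare (A * φ (φ B) + 1) := FiniteField.isSquare_of_char_two hchar _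
  have hε0 : ε ≠ 0 := fun h0 => hN <| by
    rw [h0, mul_zero, CharTwo.add_eq_zero] at hε
    exact hε
  have hδ0 : δ ≠ 0 := fun h0 => hg <| by
    rw [h0, mul_zero, CharTwo.add_eq_zero] at hδ
    simpa [h3] using congrArg φ hδ
  have hφε : φ ε = ε := CharTwo.sq_injective <| by
    have := congrArg φ hε
    simp only [map_add, map_mul, h3] at this
    simp only
    rw [pow_two, pow_two, ← this, ← hε]
    ring
  obtain ⟨r, hr0, hr⟩ := exists_norm_eq_trace_sq_mul_trace hK hm hφ h3 (div_ne_zero hδ0 hε0)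
  obtain ⟨s, hs⟩ : ∃ s, s = r + φ r + φ (φ r) := ⟨_, rfl⟩
  have hφs : φ s = s := by
    simp only [hs, map_add, h3]
    ring
  have hs0 : s ≠ 0 := fun h0 => by
    rw [← hs, h0, mul_zero] at hr
    simp [hr0] at hr
  have hδ' := congrArg φ hδ
  have hδ'' := congrArg φ hδ'
  simp only [map_add, map_mul, map_one, h3] at hδ' hδ''
  refine ⟨r / s, ?_, ?_⟩
  · simp only [map_div₀, hφs, ← add_div]
    rw [← hs, div_self hs0]
  · have e0 : A * φ (φ B) = δ * δ + 1 := by rw [← hδ]; clear * -; grind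
    have e1 : φ A * B = φ δ * φ δ + 1 := by rw [← hδ']; clear * -; grind
    have e2 : φ (φ A) * φ B = φ (φ δ) * φ (φ δ) + 1 := by rw [← hδ'']; clear * -; grind
    rw [hε, e0, e1, e2]
    simp only [map_div₀, hφs, hφε] at hr ⊢
    rw [← hs] at hr
    generalize φ (φ δ) = δ₂ at *
    generalize φ δ = δ₁ at *
    generalize φ (φ r) = r₂ at *
    generalize φ r = r₁ at *
    clear hK hφ h3 hN hg hε hδ hδ' hδ'' hφε hφs e0 e1 e2 hr0 hδ0
    field_simp at hr ⊢
    rw [hr]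
    rw [hs]
    clear * -
    grind

theorem forall_dickson_ne_zero_iff [Fintype K] {m : ℕ}
    (hK : Fintype.card K = (2 ^ m) ^ 3) (hm : 4 ≤ m) (hφ : ∀ x, φ x = x ^ 2 ^ m)
    (h3 : ∀ x, φ (φ (φ x)) = x) {A B : K} (hA : A ≠ 0) (hB : B ≠ 0) :
    (∀ r, r + φ r + φ (φ r) = 1 →
      (A * φ A * φ (φ A) + B * φ B * φ (φ B)) * (r * φ r * φ (φ r)) + 1 +
      (A * φ (φ B) * r ^ 2 + φ A * B * φ r ^ 2 + φ (φ A) * φ B * φ (φ r) ^ 2) ≠ 0) ↔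
    ((A * φ A * φ (φ A) = B * φ B * φ (φ B) ∧ φ (φ A * B) = φ A * B ∧
      φ A * B ≠ 0 ∧ φ A * B ≠ 1) ∨ (φ A * B = 1 ∧ B * φ B * φ (φ B) ≠ 1)) := by
  constructor
  · intro H
    by_cases hN : A * φ A * φ (φ A) = B * φ B * φ (φ B)
    · have hfix : φ (φ A * B) = φ A * B := by
        by_contra hg
        obtain ⟨r, hr, hdet⟩ := exists_dickson_eq_zero_of_norm_eq h3 hN hg
        exact H r hr hdet
      refine Or.inl ⟨hN, hfix, mul_ne_zero (by simpa using hA) hB, fun hg => ?_⟩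
      have hg' : φ (φ A) * φ B = 1 := by rw [← map_mul, hg, map_one]
      have hg'' : A * φ (φ B) = 1 := by simpa [h3] using congrArg φ hg'
      have h11 : (1 : K) + 1 + 1 = 1 := by rw [CharTwo.add_self_eq_zero, zero_add]
      apply H 1 (by simpa using h11)
      simp [hN, hg, hg', hg'', CharTwo.add_self_eq_zero]
    · have hg : φ A * B = 1 := by
        by_contra hg
        obtain ⟨r, hr, hdet⟩ := exists_dickson_eq_zero_of_norm_ne hK hm hφ h3 hN hg
        exact H r hr hdet
      refine Or.inr ⟨hg, fun hB1 => hN ?_⟩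
      have hg' : φ (φ A) * φ B = 1 := by rw [← map_mul, hg, map_one]
      have hg'' : A * φ (φ B) = 1 := by simpa [h3] using congrArg φ hg'
      linear_combination (-(A * φ A * φ (φ A)) - 1) * hB1 +
        hg * (φ (φ A) * φ B) * (A * φ (φ B)) + hg' * (A * φ (φ B)) + hg''
  · rintro (⟨hN, hg, -, hg1⟩ | ⟨hg, hB1⟩) r hr
    · exact dickson_ne_zero_of_norm_eq h3 hN hg hg1 hr
    · exact dickson_ne_zero_of_eq_one h3 hg hB1 hr

end Criterion

theorem stmt_0 (m : ℕ) (hm : 19 ≤ m) (q : ℕ) (hq : q = 2 ^ m)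
    (K : Type*) [Field K] [Fintype K] (hK : Fintype.card K = q ^ 3)
    (A B : K) (hA : A ≠ 0) (hB : B ≠ 0) :
    Function.Bijective (fun x : K => x ^ (q ^ 2 - q + 1) + A * x ^ (q ^ 2) + B * x) ↔
      ((A ^ (1 + q + q ^ 2) = B ^ (1 + q + q ^ 2) ∧ (A ^ q * B) ^ q = A ^ q * B ∧
          A ^ q * B ≠ 0 ∧ A ^ q * B ≠ 1) ∨
        (A ^ q * B = 1 ∧ B ^ (1 + q + q ^ 2) ≠ 1)) := by
  subst hq
  have : CharP K 2 := by
    have : Fact (Nat.Prime 2) := ⟨Nat.prime_two⟩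
    exact charP_of_card_eq_prime_pow (f := m * 3) (by rw [hK, pow_mul])
  let φ : K →+* K := iterateFrobenius K 2 m
  have hφ : ∀ x, φ x = x ^ 2 ^ m := fun x => iterateFrobenius_def ..
  have hφ2 : ∀ x, φ (φ x) = x ^ (2 ^ m) ^ 2 := fun x => by rw [hφ, hφ, ← pow_mul, ← pow_two]
  have h3 : ∀ x, φ (φ (φ x)) = x := fun x => by
    rw [hφ2, hφ, ← pow_mul, ← pow_succ', ← hK, FiniteField.pow_card]
  have hφ1 : ∃ w, φ w ≠ w := by
    obtain ⟨-, w, hw0, -, hw, -⟩ := exists_trace_zero_pair hK (by omega) hφ h3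
    exact ⟨w, fun h => hw0 (by simpa [h] using hw)⟩
  have hnorm : ∀ x : K, x ^ (1 + 2 ^ m + (2 ^ m) ^ 2) = x * φ x * φ (φ x) := fun x => by
    rw [hφ2, hφ, pow_add, pow_add, pow_one]
  have hfun : (fun x : K => x ^ ((2 ^ m) ^ 2 - 2 ^ m + 1) + A * x ^ (2 ^ m) ^ 2 + B * x) =
      fun x => φ (φ x) * x / φ x + A * φ (φ x) + B * x := by
    funext x
    rcases eq_or_ne x 0 with rfl | hx
    · simp
    · have hle : 2 ^ m ≤ (2 ^ m) ^ 2 := Nat.le_self_pow two_ne_zero _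
      rw [hφ2, hφ, pow_succ, pow_sub₀ x hx hle]
      field_simp
  rw [hfun, bijective_iff_injective_quadratic h3, injective_quadratic_iff h3 hφ1,
    forall_dickson_ne_zero_iff hK (by omega) hφ h3 hA hB]
  simp only [hnorm, ← hφ]
end

section
/- Let q = 2^m with m ≥ 19 and let K be a finite field with q^3 elements. Let A, B ∈ K be nonzero and suppose f_{A,B}(x) = x^(q^2−q+1) + A·x^(q^2) + B·x is a bijection of K, that A^q·B ≠ 1, and that E(A,B) ≠ 0. Then A^(q^2+q+1) = B^(1+q+q^2), (A^q·B)^q = A^q·B, A^q·B ≠ 0 and A^q·B ≠ 1. -/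
open Polynomial

section
variable {F : Type*} [Field F] [Fintype F]

theorem prod_X_sub_C_eq_X_pow_card_sub_X :
    ∏ a : F, (X - C a) = (X ^ Fintype.card F - X : F[X]) := by
  have hd := FiniteField.X_pow_card_sub_X_natDegree_eq F (Fintype.one_lt_card (α := F))
  have hr := FiniteField.roots_X_pow_card_sub_X F
  have hm : (X ^ Fintype.card F - X : F[X]).Monic :=
    monic_X_pow_sub (by simpa using Fintype.one_lt_card (α := F))
  have := prod_multiset_X_sub_C_of_monic_of_roots_card_eq hm (by rw [hr, hd]; rfl)
  rw [hr] at this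
  exact this

theorem X_pow_card_sub_X_dvd_of_eval_eq_zero (f : F[X]) (hf : ∀ x, f.eval x = 0) :
    (X ^ Fintype.card F - X : F[X]) ∣ f := by
  rw [← prod_X_sub_C_eq_X_pow_card_sub_X]
  refine Finset.prod_dvd_of_coprime (fun a _ b _ hab => ?_) fun a _ => ?_
  · exact pairwise_coprime_X_sub_C Function.injective_id hab
  · exact dvd_iff_isRoot.2 (hf a)

theorem exists_algebraMap_eq_of_pow_card_eq {L : Type*} [Field L] [Algebra F L] {x : L}
    (hx : x ^ Fintype.card F = x) : ∃ y : F, algebraMap F L y = x := by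
  have h := congrArg (aeval x) (prod_X_sub_C_eq_X_pow_card_sub_X (F := F))
  simp only [map_prod, map_sub, aeval_X, aeval_C, map_pow, hx, sub_self] at h
  obtain ⟨y, -, hy⟩ := Finset.prod_eq_zero_iff.1 h
  exact ⟨y, (sub_eq_zero.1 hy).symm⟩

variable [CharP F 2]

theorem dvd_of_sum_div_pow_two_pow_eq_zero {m : ℕ} (hm : 4 ≤ m) (hq : Fintype.card F = 2 ^ m)
    {b c : F[X]} (hb : b.natDegree = 3) (hirr : Irreducible b) (hc : c.natDegree ≤ 3)
    (h : ∀ x, ∑ i ∈ Finset.range m, (c.eval x / b.eval x) ^ 2 ^ i = 0) : b ∣ c := by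
  obtain ⟨l, rfl⟩ : ∃ l, m = l + 2 := ⟨m - 2, by omega⟩
  have hl : 4 ≤ 2 ^ l := by
    calc 4 = 2 ^ 2 := rfl
      _ ≤ 2 ^ l := Nat.pow_le_pow_right (by norm_num) (by omega)
  have hb0 : ∀ x, b.eval x ≠ 0 := fun x hx => by
    have h1 : b.natDegree = 1 :=
      natDegree_eq_of_degree_eq_some (degree_eq_one_of_irreducible_of_root hirr hx)
    omega
  set n := 2 ^ l with hn
  have hq4 : Fintype.card F = 4 * n := by rw [hq, hn]; ring
  set D : F[X] := X ^ Fintype.card F - X with hD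
  have hDdeg : D.natDegree = 4 * n := by
    rw [hD, FiniteField.X_pow_card_sub_X_natDegree_eq F Fintype.one_lt_card, hq4]
  have hD0 : D ≠ 0 := fun h => by rw [h] at hDdeg; simp at hDdeg; omega
  have hDder : derivative D = 1 := by
    rw [hD, derivative_sub, derivative_X_pow, derivative_X, FiniteField.cast_card_eq_zero, C_0,
      zero_mul, zero_sub, CharTwo.neg_eq]
  have hDeval : ∀ x, D.eval x = 0 := fun x => by simp [hD, FiniteField.pow_card]
  -- the trace of `c / b`, cleared of denominators
  set G : F[X] := ∑ i ∈ Finset.range (l + 1), c ^ 2 ^ i * b ^ (n - 2 ^ i) with hG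
  set Φ : F[X] := c * b ^ (2 * n - 1) + G ^ 2 with hΦ
  have hGdeg : G.natDegree ≤ 3 * n := by
    refine natDegree_sum_le_of_forall_le _ _ fun i hi => ?_
    have hi' : 2 ^ i ≤ n := Nat.pow_le_pow_right (by norm_num)
      (Nat.lt_succ_iff.1 (Finset.mem_range.1 hi))
    refine natDegree_mul_le.trans ?_
    have h1 : (c ^ 2 ^ i).natDegree ≤ 2 ^ i * 3 := natDegree_pow_le.trans (Nat.mul_le_mul_left _ hc)
    have h2 : (b ^ (n - 2 ^ i)).natDegree = (n - 2 ^ i) * 3 := by rw [natDegree_pow, hb]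
    omega
  have hΦdeg : Φ.natDegree ≤ 6 * n := by
    refine (natDegree_add_le _ _).trans (max_le (natDegree_mul_le.trans ?_) ?_)
    · rw [natDegree_pow, hb]; omega
    · rw [natDegree_pow]; omega
  have hΦeval : ∀ x, Φ.eval x = 0 := fun x => by
    have key : Φ.eval x = (b.eval x) ^ (2 * n) *
        ∑ i ∈ Finset.range (l + 2), (c.eval x / b.eval x) ^ 2 ^ i := by
      rw [Finset.sum_range_succ', hΦ, hG, CharTwo.sum_sq, eval_add, eval_finsetSum,
        mul_add, Finset.mul_sum, add_comm]
      congr 1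
      · refine Finset.sum_congr rfl fun i hi => ?_
        have hi' : 2 ^ i ≤ n := Nat.pow_le_pow_right (by norm_num)
          (Nat.lt_succ_iff.1 (Finset.mem_range.1 hi))
        simp only [eval_pow, eval_mul, mul_pow, ← pow_mul]
        rw [div_pow, mul_div_assoc', eq_div_iff (pow_ne_zero _ (hb0 x)), mul_assoc, ← pow_add,
          mul_comm, pow_succ]
        congr 2
        omega
      · simp only [eval_pow, eval_mul, pow_zero, pow_one]
        rw [mul_div_assoc', eq_div_iff (hb0 x), mul_assoc, ← pow_succ, mul_comm]
        congr 2
        omega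
    rw [key, h, mul_zero]
  obtain ⟨Ψ, hΨ⟩ := X_pow_card_sub_X_dvd_of_eval_eq_zero Φ hΦeval
  rw [← hD] at hΨ
  have hΨdeg : Ψ.natDegree ≤ 2 * n := by
    by_cases h0 : Ψ = 0
    · simp [h0]
    · have := natDegree_mul hD0 h0
      rw [← hΨ] at this
      omega
  set W : F[X] := derivative c * b + c * derivative b with hW
  have hc' : (derivative c).natDegree ≤ 2 := (natDegree_derivative_le c).trans (by omega)
  have hb' : (derivative b).natDegree ≤ 2 := (natDegree_derivative_le b).trans (by omega)
  have hWdeg : W.natDegree ≤ 5 :=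
    (natDegree_add_le _ _).trans
      (max_le (natDegree_mul_le.trans (by omega)) (natDegree_mul_le.trans (by omega)))
  have hΦder : derivative Φ = b ^ (2 * n - 2) * W := by
    have e1 : 2 * n - 1 = (2 * n - 2) + 1 := by omega
    have e2 : ((2 * n - 2 : ℕ) : F) = 0 := by
      rw [show 2 * n - 2 = 2 * (n - 1) by omega, Nat.cast_mul, Nat.cast_two, CharTwo.two_eq_zero,
        zero_mul]
    rw [hΦ, derivative_add, derivative_mul, e1, derivative_pow_succ, e2, derivative_pow]
    simp only [Nat.cast_two, CharTwo.two_eq_zero, C_0, zero_mul, zero_add, C_1, hW]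
    ring
  have hΨeval : ∀ x, Ψ.eval x = b.eval x ^ (2 * n - 2) * W.eval x := fun x => by
    have := congrArg (eval x) hΦder
    rw [hΨ, derivative_mul, hDder] at this
    simpa [hDeval] using this
  obtain ⟨e, he⟩ := X_pow_card_sub_X_dvd_of_eval_eq_zero (Ψ ^ 2 * b ^ 3 + W ^ 2) fun x => by
    have hbq : b.eval x ^ (4 * n) = b.eval x := by rw [← hq4, FiniteField.pow_card]
    have : b.eval x ^ (2 * n - 2) * b.eval x ^ (2 * n - 2) * b.eval x ^ 4 = b.eval x := by
      rw [← pow_add, ← pow_add, ← hbq]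
      rw [hbq]
      convert hbq using 2
      omega
    simp only [eval_add, eval_mul, eval_pow, hΨeval]
    apply mul_left_cancel₀ (hb0 x)
    linear_combination (W.eval x ^ 2) * this + b.eval x * W.eval x ^ 2 * CharTwo.two_eq_zero (R := F)
  rw [← hD] at he
  have hedeg : e.natDegree ≤ 9 := by
    by_cases h0 : e = 0
    · simp [h0]
    · have h1 := natDegree_mul hD0 h0
      have h2 : (Ψ ^ 2 * b ^ 3 + W ^ 2).natDegree ≤ 4 * n + 9 := by
        refine (natDegree_add_le _ _).trans (max_le (natDegree_mul_le.trans ?_) ?_)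
        · rw [natDegree_pow, natDegree_pow]; omega
        · rw [natDegree_pow]; omega
      rw [he] at h2
      omega
  have hder := congrArg derivative he
  have hder' : Ψ ^ 2 * b ^ 2 * derivative b = e + D * derivative e := by
    simp only [derivative_add, derivative_mul, derivative_pow, hDder] at hder
    simp only [Nat.cast_ofNat, map_ofNat] at hder
    grind
  have hz : W ^ 2 * derivative b + e * b = D * (derivative e * b + e * derivative b) := by
    grind
  have hz0 : W ^ 2 * derivative b + e * b = 0 := by
    by_contra hne
    have h1 : (W ^ 2 * derivative b + e * b).natDegree ≤ 12 := by
      refine (natDegree_add_le _ _).trans (max_le (natDegree_mul_le.trans ?_)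
        (natDegree_mul_le.trans ?_))
      · rw [natDegree_pow]; omega
      · omega
    have h2 : derivative e * b + e * derivative b ≠ 0 := fun h => hne (by rw [hz, h, mul_zero])
    have h3 := natDegree_mul hD0 h2
    rw [hz] at h1
    omega
  have hbb' : ¬ b ∣ derivative b := fun hdvd => by
    have h0 : derivative b ≠ 0 := fun h0 => by
      have := congrArg (coeff · 2) h0
      simp only [coeff_derivative, coeff_zero] at this
      have h3 : b.coeff 3 ≠ 0 := by
        rw [← hb]; exact leadingCoeff_ne_zero.2 hirr.ne_zero
      apply h3
      have h2 := CharTwo.two_eq_zero (R := F)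
      push_cast at this
      linear_combination this - b.coeff 3 * h2
    have := natDegree_le_of_dvd hdvd h0
    omega
  have hprime := hirr.prime
  have hbW : b ∣ W := by
    have : b ∣ W ^ 2 * derivative b := ⟨-e, by linear_combination hz0⟩
    exact hprime.dvd_of_dvd_pow ((hprime.dvd_or_dvd this).resolve_right hbb')
  have : b ∣ c * derivative b := by
    rw [hW] at hbW
    exact (dvd_add_right (dvd_mul_left _ _)).1 hbW
  exact (hprime.dvd_or_dvd this).resolve_right hbb'

theorem sum_range_sq_add_self_pow_two_pow {R : Type*} [CommRing R] [CharP R 2] (y : R) (k : ℕ) :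
    ∑ i ∈ Finset.range k, (y ^ 2 + y) ^ 2 ^ i = y ^ 2 ^ k + y := by
  induction k with
  | zero => simp [CharTwo.add_self_eq_zero]
  | succ k ih =>
    rw [Finset.sum_range_succ, ih, add_pow_char_pow, ← pow_mul, pow_succ' 2 k]
    grind

theorem exists_sq_add_mul {b : F[X]} (hb : b.natDegree = 3) (hirr : Irreducible b) (P : F[X]) :
    ∃ g c : F[X], g.natDegree ≤ 2 ∧ P = g ^ 2 + b * c := by
  have : Fact (Irreducible b) := ⟨hirr⟩
  have : CharP (AdjoinRoot b) 2 :=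
    charP_of_injective_algebraMap (algebraMap F (AdjoinRoot b)).injective 2
  have : FiniteDimensional F (AdjoinRoot b) := (AdjoinRoot.powerBasis hirr.ne_zero).finite
  have : Finite (AdjoinRoot b) := Module.finite_of_finite F
  obtain ⟨r, hr⟩ := surjective_frobenius (AdjoinRoot b) 2 (AdjoinRoot.mk b P)
  obtain ⟨g, rfl⟩ := AdjoinRoot.mk_surjective r
  rw [frobenius_def, ← map_pow, eq_comm, AdjoinRoot.mk_eq_mk] at hr
  obtain ⟨d, hd⟩ := hr
  have hg := EuclideanDomain.div_add_mod g b
  refine ⟨g % b, d + b * (g / b) ^ 2, ?_, ?_⟩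
  · have := natDegree_mod_lt g (q := b) (by omega)
    omega
  · have h2 := CharTwo.two_eq_zero (R := F[X])
    linear_combination hd - (g + (b * (g / b) + g % b)) * hg + b * (g / b) * (g % b) * h2

theorem dvd_of_exists_sq_add_self_eq_div {m : ℕ} (hm : 4 ≤ m) (hq : Fintype.card F = 2 ^ m)
    {b P : F[X]} (hb : b.natDegree = 3) (hirr : Irreducible b) (hP : P.natDegree ≤ 6)
    (h : ∀ x, ∃ y, y ^ 2 + y = P.eval x / b.eval x ^ 2) :
    b ∣ derivative P ^ 2 + P * derivative b ^ 2 := by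
  have hb0 : ∀ x, b.eval x ≠ 0 := fun x hx => by
    have h1 : b.natDegree = 1 :=
      natDegree_eq_of_degree_eq_some (degree_eq_one_of_irreducible_of_root hirr hx)
    omega
  have htr : ∀ y : F, ∑ i ∈ Finset.range m, (y ^ 2 + y) ^ 2 ^ i = 0 := fun y => by
    rw [sum_range_sq_add_self_pow_two_pow, ← hq, FiniteField.pow_card, CharTwo.add_self_eq_zero]
  obtain ⟨g, c, hg, rfl⟩ := exists_sq_add_mul hb hirr P
  have hc : c.natDegree ≤ 3 := by
    by_cases h0 : c = 0
    · simp [h0]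
    have h1 := natDegree_mul hirr.ne_zero h0
    have h2 : (b * c).natDegree ≤ 6 := by
      rw [show b * c = (g ^ 2 + b * c) - g ^ 2 by ring]
      refine (natDegree_sub_le _ _).trans (max_le hP ?_)
      rw [natDegree_pow]; omega
    omega
  have hdvd : b ∣ g + c := by
    refine dvd_of_sum_div_pow_two_pow_eq_zero hm hq hb hirr
      ((natDegree_add_le _ _).trans (max_le (by omega) hc)) fun x => ?_
    obtain ⟨y, hy⟩ := h x
    have : (g + c).eval x / b.eval x = (y + g.eval x / b.eval x) ^ 2 + (y + g.eval x / b.eval x) := by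
      have hbx := hb0 x
      have h2 := CharTwo.two_eq_zero (R := F)
      have e1 : (g ^ 2 + b * c).eval x / b.eval x ^ 2 =
          (g.eval x / b.eval x) ^ 2 + c.eval x / b.eval x := by
        simp only [eval_add, eval_mul, eval_pow]
        field_simp
      rw [e1] at hy
      rw [eval_add, add_div]
      linear_combination -hy - (y * (g.eval x / b.eval x) + (g.eval x / b.eval x) ^ 2) * h2
    simp only [this, htr]
  obtain ⟨d, hd⟩ := hdvd
  have hdC : derivative d = 0 := by
    have : d.natDegree = 0 := by
      by_cases h0 : d = 0
      · simp [h0]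
      have h1 := natDegree_mul hirr.ne_zero h0
      have h2 : (g + c).natDegree ≤ 3 := (natDegree_add_le _ _).trans (max_le (by omega) hc)
      rw [hd] at h2
      omega
    exact derivative_of_natDegree_zero this
  have h2 := CharTwo.two_eq_zero (R := F[X])
  have hc' : c = b * d - g := by rw [← hd]; ring
  have hder : derivative (g ^ 2 + b * c) = derivative b * g + b * derivative g := by
    simp only [hc', derivative_add, derivative_mul, derivative_sub, derivative_pow, hdC,
      Nat.cast_ofNat, map_ofNat, h2]
    linear_combination (b * d * derivative b - derivative b * g - b * derivative g) * h2
  rw [hder, hc']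
  refine ⟨b * derivative g ^ 2 + d * b * derivative b ^ 2 - g * derivative b ^ 2, ?_⟩
  linear_combination (derivative b ^ 2 * g ^ 2 + b * derivative b * derivative g * g) * h2

theorem hessian_eq_of_exists_sq_add_self {m : ℕ} (hm : 4 ≤ m) (hq : Fintype.card F = 2 ^ m)
    {a₀ a₂ b₀ b₁ b₂ b₃ : F} (hb₃ : b₃ ≠ 0)
    (hb : ∀ x, b₃ * x ^ 3 + b₂ * x ^ 2 + b₁ * x + b₀ ≠ 0)
    (h : ∀ x, ∃ y, y ^ 2 + y = (a₂ * x ^ 2 + x + a₀) ^ 3 /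
      (b₃ * x ^ 3 + b₂ * x ^ 2 + b₁ * x + b₀) ^ 2 + 1) :
    b₃ * b₁ + b₂ ^ 2 = a₂ ∧ b₃ * b₀ + b₂ * b₁ = 1 := by
  set a : F[X] := C a₂ * X ^ 2 + C 1 * X + C a₀ with ha
  set b : F[X] := C b₃ * X ^ 3 + C b₂ * X ^ 2 + C b₁ * X + C b₀ with hbdef
  have hadeg : a.natDegree ≤ 2 := natDegree_quadratic_le
  have hbdeg : b.natDegree = 3 := natDegree_cubic hb₃
  have haeval : ∀ x, a.eval x = a₂ * x ^ 2 + x + a₀ := fun x => by simp [ha]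
  have hbeval : ∀ x, b.eval x = b₃ * x ^ 3 + b₂ * x ^ 2 + b₁ * x + b₀ := fun x => by simp [hbdef]
  have hirr : Irreducible b :=
    irreducible_of_degree_le_three_of_not_isRoot (by rw [hbdeg]; decide) fun x hx =>
      hb x (by rw [← hbeval]; exact hx)
  have ha0 : ¬ b ∣ a := fun hdvd => by
    have h0 : a ≠ 0 := fun h0 => by
      have := congrArg (coeff · 1) h0
      simp [ha, coeff_X] at this
    have := natDegree_le_of_dvd hdvd h0
    omega
  have h2 := CharTwo.two_eq_zero (R := F[X])
  have hPdeg : (a ^ 3 + b ^ 2).natDegree ≤ 6 := by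
    refine (natDegree_add_le _ _).trans (max_le ?_ ?_) <;> rw [natDegree_pow] <;> omega
  have key := dvd_of_exists_sq_add_self_eq_div hm hq hbdeg hirr hPdeg fun x => by
    obtain ⟨y, hy⟩ := h x
    refine ⟨y, ?_⟩
    have hbx := hb x
    rw [hy, eval_add, eval_pow, eval_pow, haeval, hbeval, add_div, div_self (pow_ne_zero _ hbx)]
  have ha' : derivative a = 1 := by
    simp [ha, one_add_one_eq_two, CharTwo.two_eq_zero]
  have hb' : derivative b = C b₃ * X ^ 2 + C b₁ := by
    simp only [hbdef, derivative_add, derivative_mul, derivative_C, derivative_X_pow, derivative_X]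
    simp only [Nat.cast_ofNat, map_ofNat]
    linear_combination (C b₃ * X ^ 2 + C b₂ * X) * h2
  have hprime := hirr.prime
  have h3 : b ∣ a ^ 3 * (a + derivative b ^ 2) := by
    have e : derivative (a ^ 3 + b ^ 2) = a ^ 2 := by
      simp only [derivative_add, derivative_pow, ha']
      simp only [Nat.cast_ofNat, map_ofNat]
      linear_combination (a ^ 2 + b * derivative b) * h2
    rw [e] at key
    refine (dvd_add_left (dvd_mul_left b (b * derivative b ^ 2))).1 ?_
    convert key using 1
    ring
  have h4 : b ∣ a + derivative b ^ 2 :=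
    (hprime.dvd_or_dvd h3).resolve_left fun h => ha0 (hprime.dvd_of_dvd_pow h)
  set r : F[X] := C (a₂ + b₃ * b₁ + b₂ ^ 2) * X ^ 2 + C (1 + b₃ * b₀ + b₂ * b₁) * X +
    C (a₀ + b₁ ^ 2 + b₂ * b₀) with hr
  have h5 : b ∣ r := by
    have : r = (a + derivative b ^ 2) - (C b₃ * X + C b₂) * b := by
      rw [hr, hb', ha, hbdef]
      simp only [C_add, C_mul, C_pow, C_1]
      grind
    rw [this]
    exact dvd_sub h4 (dvd_mul_left _ _)
  have h6 : r = 0 := by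
    by_contra hne
    have h7 : r.natDegree ≤ 2 := natDegree_quadratic_le
    have := natDegree_le_of_dvd h5 hne
    omega
  have hcoeff : ∀ u v w : F, C u * X ^ 2 + C v * X + C w = (0 : F[X]) → u = 0 ∧ v = 0 :=
    fun u v w h => by
      have c2 := congrArg (coeff · 2) h
      have c1 := congrArg (coeff · 1) h
      simp [coeff_C] at c1 c2
      exact ⟨c2, c1⟩
  obtain ⟨c2, c1⟩ := hcoeff _ _ _ h6
  have h2' := CharTwo.two_eq_zero (R := F)
  exact ⟨by linear_combination c2 - a₂ * h2', by linear_combination c1 - h2'⟩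

theorem exists_sq_add_self_of_forall_cubic_ne_zero {a b : F}
    (h : ∀ w, w ^ 3 + a * w + b ≠ 0) : ∃ y, y ^ 2 + y = a ^ 3 / b ^ 2 + 1 := by
  obtain ⟨L, _, _, _⟩ : ∃ (L : Type _) (_ : Field L) (_ : Algebra F L), IsAlgClosed L :=
    ⟨AlgebraicClosure F, inferInstance, inferInstance, inferInstance⟩
  have : CharP L 2 := charP_of_injective_algebraMap (algebraMap F L).injective 2
  have h2 := CharTwo.two_eq_zero (R := L)
  let φ := FiniteField.frobeniusAlgHom F L
  have hfix : ∀ x : L, φ x = x → ∃ y, algebraMap F L y = x := fun x hx =>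
    exists_algebraMap_eq_of_pow_card_eq hx
  obtain ⟨a', ha'⟩ : ∃ x, x = algebraMap F L a := ⟨_, rfl⟩
  obtain ⟨b', hb'⟩ : ∃ x, x = algebraMap F L b := ⟨_, rfl⟩
  have hφa : φ a' = a' := ha' ▸ φ.commutes a
  have hφb : φ b' = b' := hb' ▸ φ.commutes b
  have hroot : ∀ x : L, x ^ 3 + a' * x + b' = 0 → φ x ≠ x := fun x hx hx' => by
    obtain ⟨y, rfl⟩ := hfix x hx'
    refine h y ((algebraMap F L).injective ?_)
    simpa [ha', hb'] using hx
  obtain ⟨ρ, hρ⟩ : ∃ ρ : L, ρ ^ 3 + a' * ρ + b' = 0 := by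
    obtain ⟨ρ, hρ⟩ := IsAlgClosed.exists_aeval_eq_zero L (C 1 * X ^ 3 + C 0 * X ^ 2 + C a * X + C b)
      (by rw [degree_cubic one_ne_zero]; decide)
    exact ⟨ρ, by simpa [ha', hb'] using hρ⟩
  obtain ⟨σ, hσ⟩ : ∃ σ, σ = φ ρ := ⟨_, rfl⟩
  obtain ⟨τ, hτ⟩ : ∃ τ, τ = φ σ := ⟨_, rfl⟩
  have hne : ρ + σ ≠ 0 := fun h0 =>
    hroot ρ hρ (by rw [← hσ]; exact (CharTwo.add_eq_zero.1 h0).symm)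
  have hσ3 : σ ^ 3 + a' * σ + b' = 0 := by
    have := congrArg φ hρ
    simpa only [map_add, map_mul, map_pow, hφa, hφb, map_zero, ← hσ] using this
  have h1 : ρ ^ 2 + ρ * σ + σ ^ 2 = a' := by
    have : (ρ + σ) * (ρ ^ 2 + ρ * σ + σ ^ 2 + a') = 0 := by
      linear_combination hρ + hσ3 + (ρ ^ 2 * σ + ρ * σ ^ 2 - b') * h2
    exact CharTwo.add_eq_zero.1 ((mul_eq_zero.1 this).resolve_left hne)
  have hb1 : b' = ρ * σ * (ρ + σ) := by linear_combination hρ - ρ * h1 - a' * ρ * h2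
  have h1' : σ ^ 2 + σ * τ + τ ^ 2 = a' := by
    have := congrArg φ h1
    simpa only [map_add, map_mul, map_pow, hφa, ← hσ, ← hτ] using this
  have hne' : ρ + τ ≠ 0 := fun h0 => by
    refine hroot (ρ + σ) ?_ ?_
    · linear_combination hρ + hσ3 - hb1 + (ρ ^ 2 * σ + ρ * σ ^ 2) * h2
    · rw [map_add, ← hσ, ← hτ, ← CharTwo.add_eq_zero.1 h0, add_comm]
  have hτ' : τ = ρ + σ := by
    have : (ρ + τ) * (ρ + σ + τ) = 0 := by
      linear_combination h1 - h1' + (ρ * τ + τ * σ + τ ^ 2) * h2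
    exact (CharTwo.add_eq_zero.1 ((mul_eq_zero.1 this).resolve_left hne')).symm
  have hφτ : φ τ = ρ := by
    rw [hτ', map_add, ← hσ, ← hτ, hτ']
    linear_combination σ * h2
  have hb0 : b' ≠ 0 := fun h0 => by
    refine h 0 ?_
    rw [hb', map_eq_zero] at h0
    simp [h0]
  obtain ⟨y, hy⟩ := hfix ((ρ ^ 2 * σ + σ ^ 2 * τ + τ ^ 2 * ρ) / b') (by
    rw [map_div₀, hφb]
    simp only [map_add, map_mul, map_pow, ← hσ, ← hτ, hφτ]
    ring)
  refine ⟨y, (algebraMap F L).injective ?_⟩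
  simp only [map_add, map_pow, map_div₀, map_one, hy, ← ha', ← hb']
  have key : (ρ ^ 2 * σ + σ ^ 2 * τ + τ ^ 2 * ρ) ^ 2 + (ρ ^ 2 * σ + σ ^ 2 * τ + τ ^ 2 * ρ) * b' =
      a' ^ 3 + b' ^ 2 := by
    have : ∀ x y : L, (x ^ 2 * y + y ^ 2 * (x + y) + (x + y) ^ 2 * x) ^ 2 +
        (x ^ 2 * y + y ^ 2 * (x + y) + (x + y) ^ 2 * x) * (x * y * (x + y)) =
        (x ^ 2 + x * y + y ^ 2) ^ 3 + (x * y * (x + y)) ^ 2 := fun x y => by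
      clear * -
      grind
    rw [hb1, ← h1, hτ', this]
  field_simp
  linear_combination key

theorem hessian_eq_of_forall_cubic_ne_zero {m : ℕ} (hm : 4 ≤ m) (hq : Fintype.card F = 2 ^ m)
    {a₀ a₂ b₀ b₁ b₂ b₃ : F} (hb₃ : b₃ ≠ 0)
    (h : ∀ x w, w ^ 3 + (a₂ * x ^ 2 + x + a₀) * w + (b₃ * x ^ 3 + b₂ * x ^ 2 + b₁ * x + b₀) ≠ 0) :
    b₃ * b₁ + b₂ ^ 2 = a₂ ∧ b₃ * b₀ + b₂ * b₁ = 1 :=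
  hessian_eq_of_exists_sq_add_self hm hq hb₃ (fun x => by simpa using h x 0)
    fun x => exists_sq_add_self_of_forall_cubic_ne_zero (h x)

theorem exists_norm_add_trace_mul_trace_sq_eq_zero {K : Type*} [Field K] [CharP K 2] [Algebra F K]
    {m : ℕ} (hm : 4 ≤ m) (hq : Fintype.card F = 2 ^ m)
    (φ : K →+* K) (hφF : ∀ y, φ (algebraMap F K y) = algebraMap F K y)
    (hφ : ∀ x, φ (φ (φ x)) = x)
    (hfix : ∀ x, φ x = x → ∃ y, algebraMap F K y = x) {z γ : K} (hz : φ z ≠ z) (hγ : γ ≠ 0) :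
    ∃ s ≠ 0, s * φ s * φ (φ s) +
      (s + φ s + φ (φ s)) * (γ * s + φ (γ * s) + φ (φ (γ * s))) ^ 2 = 0 := by
  have h2 := CharTwo.two_eq_zero (R := K)
  have hφ0 : ∀ x, φ x = 0 → x = 0 := fun x => (map_eq_zero φ).1
  obtain ⟨s, hs, hTs, hTγs⟩ : ∃ s ≠ 0, s + φ s + φ (φ s) = 0 ∧
      γ * s + φ (γ * s) + φ (φ (γ * s)) = 0 := by
    by_cases hγf : φ γ = γ
    · refine ⟨z + φ z, fun h0 => hz (CharTwo.add_eq_zero.1 h0).symm, ?_, ?_⟩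
      · simp only [map_add, hφ]
        linear_combination (z + φ z + φ (φ z)) * h2
      · simp only [map_add, map_mul, hφ, hγf]
        linear_combination γ * (z + φ z + φ (φ z)) * h2
    · refine ⟨φ γ + φ (φ γ), fun h0 => hγf ?_, ?_, ?_⟩
      · exact (φ.injective (CharTwo.add_eq_zero.1 h0)).symm
      · simp only [map_add, hφ]
        linear_combination (γ + φ γ + φ (φ γ)) * h2
      · simp only [map_add, map_mul, hφ]
        linear_combination (γ * φ γ + φ γ * φ (φ γ) + φ (φ γ) * γ) * h2
  by_contra! hcon
  obtain ⟨e, he⟩ : ∃ e, e = γ * s := ⟨_, rfl⟩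
  rw [← he] at hTγs
  have he0 : e ≠ 0 := he ▸ mul_ne_zero hγ hs
  obtain ⟨s', hs'⟩ : ∃ s', φ s = s' := ⟨_, rfl⟩
  obtain ⟨e', he'⟩ : ∃ e', φ e = e' := ⟨_, rfl⟩
  have hs'' : φ s' = s + s' := by
    rw [hs'] at hTs
    exact (CharTwo.add_eq_zero.1 hTs).symm
  have he'' : φ e' = e + e' := by
    rw [he'] at hTγs
    exact (CharTwo.add_eq_zero.1 hTγs).symm
  have he0' : e' ≠ 0 := fun h0 => he0 (hφ0 e (he'.trans h0))
  have he0'' : e + e' ≠ 0 := fun h0 => he0' (hφ0 e' (he''.trans h0))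
  have hs0' : s' ≠ 0 := fun h0 => hs (hφ0 s (hs'.trans h0))
  have hs0'' : s + s' ≠ 0 := fun h0 => hs0' (hφ0 s' (hs''.trans h0))
  obtain ⟨u, hu⟩ : ∃ u, u = e / (e' * (e + e')) := ⟨_, rfl⟩
  obtain ⟨u', hu'⟩ : ∃ u', u' = e' / ((e + e') * e) := ⟨_, rfl⟩
  have hee : e' + (e + e') = e := by linear_combination e' * h2
  have hφu : φ u = u' := by
    rw [hu, hu', map_div₀, map_mul, map_add, he', he'', hee]
  have hφu' : φ u' = u + u' := by
    rw [hu, hu', map_div₀, map_mul, map_add, he', he'', hee]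
    field_simp
    linear_combination e * e' * h2
  have huv : e * u' + e' * u = 1 := by
    rw [hu, hu']
    field_simp
    ring
  clear hu hu'
  obtain ⟨k, hk⟩ : ∃ k, k * (s * s' * (s + s')) = 1 :=
    ⟨_, inv_mul_cancel₀ (mul_ne_zero (mul_ne_zero hs hs0') hs0'')⟩
  have hNs : φ (s * s' * (s + s')) = s * s' * (s + s') := by
    simp only [map_mul, map_add, hs', hs'']
    linear_combination s' ^ 2 * (s + s') * h2
  have hφk : φ k = k := by
    have := congrArg φ hk
    rw [map_mul, hNs, map_one, ← hk] at this
    exact mul_right_cancel₀ (mul_ne_zero (mul_ne_zero hs hs0') hs0'') this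
  obtain ⟨a₂, ha₂⟩ := hfix (e ^ 2 + e * e' + e' ^ 2) (by
    simp only [map_mul, map_add, map_pow, he', he'']; clear * -; grind)
  obtain ⟨a₀, ha₀⟩ := hfix (u ^ 2 + u * u' + u' ^ 2) (by
    simp only [map_mul, map_add, map_pow, hφu, hφu']; clear * -; grind)
  obtain ⟨n₃, hn₃⟩ := hfix (e * e' * (e + e')) (by
    simp only [map_mul, map_add, he', he'']; clear * -; grind)
  obtain ⟨n₂, hn₂⟩ := hfix (e * e' * (u + u') + (e * u' + e' * u) * (e + e')) (by
    simp only [map_mul, map_add, he', he'', hφu, hφu']; clear * -; grind)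
  obtain ⟨n₁, hn₁⟩ := hfix (u * u' * (e + e') + (e * u' + e' * u) * (u + u')) (by
    simp only [map_mul, map_add, he', he'', hφu, hφu']; clear * -; grind)
  obtain ⟨n₀, hn₀⟩ := hfix (u * u' * (u + u')) (by
    simp only [map_mul, map_add, hφu, hφu']; clear * -; grind)
  obtain ⟨t₁, ht₁⟩ := hfix (k * (s * e' + s' * e)) (by
    simp only [map_mul, map_add, he', he'', hs', hs'', hφk]; clear * -; grind)
  obtain ⟨t₀, ht₀⟩ := hfix (k * (s * u' + s' * u)) (by
    simp only [map_mul, map_add, hs', hs'', hφu, hφu', hφk]; clear * -; grind)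
  obtain ⟨c1, c2⟩ := hessian_eq_of_forall_cubic_ne_zero hm hq (a₀ := a₀) (a₂ := a₂) (b₃ := n₃)
    (b₂ := n₂) (b₁ := n₁ + t₁) (b₀ := n₀ + t₀) (fun h0 => by
      rw [h0, map_zero] at hn₃
      exact mul_ne_zero (mul_ne_zero he0 he0') he0'' hn₃.symm) fun p w hpw => by
    obtain ⟨P, hP⟩ : ∃ P, algebraMap F K p = P := ⟨_, rfl⟩
    obtain ⟨W, hW⟩ : ∃ W, algebraMap F K w = W := ⟨_, rfl⟩
    have hφP : φ P = P := hP ▸ hφF p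
    have hφW : φ W = W := hW ▸ hφF w
    have hpw' := congrArg (algebraMap F K) hpw
    simp only [map_add, map_mul, map_pow, map_zero, ha₂, ha₀, hn₃, hn₂, hn₁, hn₀, ht₁, ht₀,
      hP, hW] at hpw'
    have hr : P * e + u + W ≠ 0 := fun h0 => by
      have h1 := congrArg φ h0
      have h3 := congrArg φ h1
      simp only [map_add, map_mul, map_zero, hφP, hφW, he', he'', hφu, hφu'] at h1 h3
      have hW0 : W = 0 := by
        linear_combination h0 + h1 + h3 - (P * (e + e') + u + u' + W) * h2
      refine one_ne_zero (α := K) ?_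
      linear_combination e * h1 + e' * h0 - huv - (e + e') * hW0 - P * e * e' * h2
    refine hcon (s * (P * e + u + W)) (mul_ne_zero hs hr) ?_
    have hT : γ * (s * (P * e + u + W)) + φ (γ * (s * (P * e + u + W))) +
        φ (φ (γ * (s * (P * e + u + W)))) = 1 := by
      rw [← mul_assoc, ← he]
      simp only [map_add, map_mul, he', he'', hφu, hφu', hφP, hφW]
      linear_combination huv + (P * (e ^ 2 + e * e' + e' ^ 2) + e * u + e' * u' + (e + e') * W) * h2
    rw [hT, one_pow, mul_one]
    simp only [map_add, map_mul, he', he'', hφu, hφu', hφP, hφW, hs', hs'']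
    clear * - hpw' hk huv
    grind
  have hc1 := congrArg (algebraMap F K) c1
  have hc2 := congrArg (algebraMap F K) c2
  simp only [map_add, map_mul, map_pow, map_one, ha₂, hn₃, hn₂, hn₁, hn₀, ht₁, ht₀] at hc1 hc2
  have hτ₁ : s * e' + s' * e = 0 := by
    have : e * e' * (e + e') * (s * e' + s' * e) = 0 := by
      clear * - hc1 hk huv
      grind
    exact (mul_eq_zero.1 this).resolve_left (mul_ne_zero (mul_ne_zero he0 he0') he0'')
  have hτ₀ : s * u' + s' * u = 0 := by
    have : e * e' * (e + e') * (s * u' + s' * u) = 0 := by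
      clear * - hc2 hk huv hτ₁
      grind
    exact (mul_eq_zero.1 this).resolve_left (mul_ne_zero (mul_ne_zero he0 he0') he0'')
  refine hs ?_
  linear_combination e * hτ₀ + u * hτ₁ - s * huv - e * s' * u * h2

end

section
variable {K : Type*} [Field K]

theorem eq_zero_of_forall_add_mul_map_eq_zero {φ : K →+* K} (hφ : ∀ x, φ (φ (φ x)) = x) {z : K}
    (hz : φ z ≠ z) {l₀ l₁ l₂ : K} (h : ∀ x, l₀ * x + l₁ * φ x + l₂ * φ (φ x) = 0) :
    l₀ = 0 ∧ l₁ = 0 ∧ l₂ = 0 := by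
  have hz1 : φ (φ z) - φ z ≠ 0 := fun h0 => hz (φ.injective (sub_eq_zero.1 h0))
  have hz2 : φ (φ z) - z ≠ 0 := fun h0 => hz (by
    have := congrArg φ (sub_eq_zero.1 h0)
    rw [hφ] at this
    exact this.symm)
  have e0 := h 1
  have e1 := h z
  have e2 := h (z ^ 2)
  simp only [map_pow, map_one, mul_one] at e0 e1 e2
  have h2 : l₂ = 0 := by
    have : l₂ * ((φ (φ z) - φ z) * (φ (φ z) - z)) = 0 := by
      linear_combination e2 - (z + φ z) * e1 + z * φ z * e0
    exact (mul_eq_zero.1 this).resolve_right (mul_ne_zero hz1 hz2)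
  have h1 : l₁ = 0 := by
    have : l₁ * (φ z - z) = 0 := by
      linear_combination e1 - z * e0 - (φ (φ z) - z) * h2
    exact (mul_eq_zero.1 this).resolve_right (sub_ne_zero.2 hz)
  exact ⟨by linear_combination e0 - h1 - h2, h1, h2⟩

theorem exists_add_mul_map_eq_zero_of_det_eq_zero [Finite K] {φ : K →+* K}
    (hφ : ∀ x, φ (φ (φ x)) = x) {z : K} (hz : φ z ≠ z) {α β : K}
    (hdet : (!![1, β, α; φ α, 1, φ β; φ (φ β), φ (φ α), 1]).det = 0) :
    ∃ d ≠ 0, d + β * φ d + α * φ (φ d) = 0 := by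
  by_contra! hcon
  let M : K →+ K := AddMonoidHom.id K + (AddMonoidHom.mulLeft β).comp φ.toAddMonoidHom +
    (AddMonoidHom.mulLeft α).comp (φ.comp φ).toAddMonoidHom
  have hM : ∀ d, M d = d + β * φ d + α * φ (φ d) := fun d => rfl
  have hinj : Function.Injective M := (injective_iff_map_eq_zero M).2 fun d hd => by
    by_contra h0
    exact hcon d h0 (hM d ▸ hd)
  have hsurj : Function.Surjective M := Finite.surjective_of_injective hinj
  obtain ⟨l, hl, hlM⟩ := Matrix.exists_vecMul_eq_zero_iff.2 hdet
  have h0 := congrFun hlM 0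
  have h1 := congrFun hlM 1
  have h2 := congrFun hlM 2
  simp [Matrix.vecMul, dotProduct, Fin.sum_univ_three] at h0 h1 h2
  obtain ⟨l0, l1, l2⟩ := eq_zero_of_forall_add_mul_map_eq_zero hφ hz (l₀ := l 0) (l₁ := l 1)
    (l₂ := l 2) fun x => by
      obtain ⟨d, rfl⟩ := hsurj x
      simp only [hM, map_add, map_mul, hφ]
      linear_combination d * h0 + φ d * h1 + φ (φ d) * h2
  refine hl (funext fun i => ?_)
  fin_cases i <;> assumption

theorem injective_mul_add_mul_map [CharP K 2] {φ : K →+* K} (hφ : ∀ x, φ (φ (φ x)) = x) {A B : K}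
    {f : K → K} (hf : ∀ x, f x = φ (φ x) * x / φ x + A * φ (φ x) + B * x)
    (hinj : Function.Injective f) :
    Function.Injective fun x => x * (x + φ (φ B) * φ x + φ (φ A) * φ (φ x)) := by
  have hφ0 : ∀ {x}, x ≠ 0 → φ x ≠ 0 := fun h => (map_ne_zero φ).2 h
  have hN : ∀ x ≠ 0, f x⁻¹ * (x * φ x * φ (φ x)) =
      φ (x * (x + φ (φ B) * φ x + φ (φ A) * φ (φ x))) := fun x hx => by
    have h1 := hφ0 hx
    have h2 := hφ0 h1
    simp only [hf, map_inv₀, map_mul, map_add, hφ]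
    field_simp
    ring
  have hf0 : f 0 = 0 := by simp [hf]
  have hzero : ∀ x, x * (x + φ (φ B) * φ x + φ (φ A) * φ (φ x)) = 0 → x = 0 := fun x h => by
    by_contra hx
    have := hN x hx
    rw [h, map_zero] at this
    have h0 : f x⁻¹ = 0 := (mul_eq_zero.1 this).resolve_right
      (mul_ne_zero (mul_ne_zero hx (hφ0 hx)) (hφ0 (hφ0 hx)))
    exact inv_ne_zero hx (hinj (h0.trans hf0.symm))
  intro x y hxy
  simp only at hxy
  by_cases hy : y = 0
  · rw [hy] at hxy ⊢
    exact hzero x (hxy.trans (zero_mul _))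
  by_cases hx : x = 0
  · rw [hx] at hxy ⊢
    exact (hzero y (hxy.symm.trans (zero_mul _))).symm
  have hNx := mul_ne_zero (mul_ne_zero hx (hφ0 hx)) (hφ0 (hφ0 hx))
  have hNy := mul_ne_zero (mul_ne_zero hy (hφ0 hy)) (hφ0 (hφ0 hy))
  obtain ⟨ν, hν⟩ : ∃ ν, ν = x * φ x * φ (φ x) / (y * φ y * φ (φ y)) := ⟨_, rfl⟩
  have hφν : φ ν = ν := by
    simp only [hν, map_div₀, map_mul, hφ]
    congr 1 <;> ring
  have hν0 : ν ≠ 0 := hν ▸ div_ne_zero hNx hNy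
  have hfν : f (ν * x⁻¹) = ν * f x⁻¹ := by
    have h1 := hφ0 hx
    have h2 := hφ0 h1
    simp only [hf, map_mul, hφν, map_inv₀]
    field_simp
  have hxy' : ν * x⁻¹ = y⁻¹ := hinj (by
    have e1 := hN x hx
    have e2 := hN y hy
    rw [hxy, ← e2, ← eq_div_iff hNx] at e1
    rw [hfν, e1, hν, div_mul_div_comm, mul_comm (y * φ y * φ (φ y)) (x * φ x * φ (φ x)),
      mul_comm (f y⁻¹), ← mul_assoc, mul_div_cancel_left₀ _ (mul_ne_zero hNx hNy)])
  have hxν : x = ν * y := by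
    field_simp at hxy'
    exact hxy'.symm
  have hsq : ν ^ 2 = 1 := by
    have hh : y * (y + φ (φ B) * φ y + φ (φ A) * φ (φ y)) ≠ 0 := fun h => hy (hzero y h)
    refine mul_right_cancel₀ hh ?_
    rw [hxν] at hxy
    simp only [map_mul, hφν] at hxy
    linear_combination hxy
  rw [hxν, CharTwo.sq_injective (hsq.trans (one_pow 2).symm), one_mul]

theorem one_add_mul_norm_add_trace_ne_zero [CharP K 2] [Finite K] {φ : K →+* K}
    (hφ : ∀ x, φ (φ (φ x)) = x) {z : K} (hz : φ z ≠ z) {A B : K} {f : K → K}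
    (hf : ∀ x, f x = φ (φ x) * x / φ x + A * φ (φ x) + B * x) (hinj : Function.Injective f)
    {s : K} (hs : s + φ s + φ (φ s) = 1) :
    1 + (A * φ A * φ (φ A) + B * φ B * φ (φ B)) * (s * φ s * φ (φ s)) +
      (A * φ (φ B) * s ^ 2 + φ (A * φ (φ B) * s ^ 2) + φ (φ (A * φ (φ B) * s ^ 2))) ≠ 0 := by
  intro h0
  have h2 := CharTwo.two_eq_zero (R := K)
  obtain ⟨d, hd, hM⟩ := exists_add_mul_map_eq_zero_of_det_eq_zero hφ hz (α := φ (φ A) * φ (φ s))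
    (β := φ (φ B) * s) (by
      rw [Matrix.det_fin_three]
      simp only [map_mul, map_pow, hφ] at h0
      simp [hφ]
      linear_combination h0 - (A * φ (φ B) * s ^ 2 + φ A * B * φ s ^ 2 +
        φ (φ A) * φ B * φ (φ s) ^ 2) * h2)
  have hne : d * φ (s + 1) + d ≠ d * φ (s + 1) := by simpa using hd
  refine hne (injective_mul_add_mul_map hφ hf hinj ?_)
  obtain ⟨s', hs'⟩ : ∃ s', s' = φ s := ⟨_, rfl⟩
  have hs'' : φ s' = s + s' + 1 := by
    rw [← hs'] at hs
    linear_combination hs - (s + s') * h2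
  rw [← hs', hs''] at hM
  simp only [map_add, map_mul, map_one, ← hs', hs'']
  clear * - hM
  grind

theorem map_eq_self_of_forall_trace_sq_ne_zero [CharP K 2] {φ : K →+* K}
    (hφ : ∀ x, φ (φ (φ x)) = x) {γ : K}
    (h : ∀ s, s + φ s + φ (φ s) = 1 → γ * s + φ (γ * s) + φ (φ (γ * s)) ≠ 0) : φ γ = γ := by
  have h2 := CharTwo.two_eq_zero (R := K)
  by_contra hγ
  have hγ0 : γ ≠ 0 := fun h0 => hγ (by rw [h0, map_zero])
  have hγ1 : φ γ ≠ 0 := (map_ne_zero φ).2 hγ0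
  have hγ2 : φ (φ γ) ≠ 0 := (map_ne_zero φ).2 hγ1
  obtain ⟨δ, hδ⟩ : ∃ δ, δ = γ⁻¹ + (φ (φ γ))⁻¹ := ⟨_, rfl⟩
  have hδ0 : δ ≠ 0 := fun h0 => hγ (by
    rw [h0, eq_comm, CharTwo.add_eq_zero, inv_inj] at hδ
    have := congrArg φ hδ
    rwa [hφ] at this)
  have hδ1 : φ δ ≠ 0 := (map_ne_zero φ).2 hδ0
  have hδ2 : φ (φ δ) ≠ 0 := (map_ne_zero φ).2 hδ1
  refine h (γ⁻¹ * (δ⁻¹ + φ δ⁻¹)) ?_ ?_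
  · have e0 : δ⁻¹ * (γ⁻¹ + (φ (φ γ))⁻¹) = 1 := by rw [← hδ, inv_mul_cancel₀ hδ0]
    have e1 := congrArg φ e0
    have e2 := congrArg φ e1
    simp only [map_mul, map_add, map_inv₀, map_one, hφ] at e0 e1 e2 ⊢
    linear_combination e0 + e1 + e2 + h2
  · rw [mul_inv_cancel_left₀ hγ0]
    simp only [map_add, hφ]
    linear_combination (δ⁻¹ + φ δ⁻¹ + φ (φ δ⁻¹)) * h2

theorem norm_eq_and_map_eq_self_of_injective {F : Type*} [Field F] [Fintype F] [CharP F 2]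
    [CharP K 2] [Finite K] [Algebra F K] {m : ℕ} (hm : 4 ≤ m) (hq : Fintype.card F = 2 ^ m)
    {φ : K →+* K} (hφF : ∀ y, φ (algebraMap F K y) = algebraMap F K y)
    (hφ : ∀ x, φ (φ (φ x)) = x) (hfix : ∀ x, φ x = x → ∃ y, algebraMap F K y = x)
    {z : K} (hz : φ z ≠ z) {A B : K} {f : K → K}
    (hf : ∀ x, f x = φ (φ x) * x / φ x + A * φ (φ x) + B * x) (hinj : Function.Injective f)
    (hAB : φ A * B ≠ 1) :
    A * φ A * φ (φ A) = B * φ B * φ (φ B) ∧ φ (φ A * B) = φ A * B := by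
  have h2 := CharTwo.two_eq_zero (R := K)
  have key := fun s => one_add_mul_norm_add_trace_ne_zero hφ hz hf hinj (s := s)
  obtain ⟨n, hn⟩ : ∃ n, n = A * φ A * φ (φ A) + B * φ B * φ (φ B) := ⟨_, rfl⟩
  obtain ⟨c, hc⟩ : ∃ c, c = A * φ (φ B) := ⟨_, rfl⟩
  have hφc : φ c = φ A * B := by rw [hc, map_mul, hφ]
  have hφn : φ n = n := by
    simp only [hn, map_add, map_mul, hφ]
    ring
  simp only [← hn, ← hc] at key
  have hc1 : 1 + c ≠ 0 := fun h0 => hAB (by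
    rw [← hφc, ← CharTwo.add_eq_zero.1 h0, map_one])
  by_cases hn0 : n = 0
  · obtain ⟨γ, hγ⟩ := surjective_frobenius K 2 (1 + c)
    rw [frobenius_def] at hγ
    have hγφ : φ γ = γ := map_eq_self_of_forall_trace_sq_ne_zero hφ fun s hs h0 => by
      refine key s hs ?_
      have e0 : (s + φ s + φ (φ s)) ^ 2 = 1 := by rw [hs, one_pow]
      have e1 : φ γ ^ 2 = 1 + φ c := by rw [← map_pow, hγ, map_add, map_one]
      have e2 : φ (φ γ) ^ 2 = 1 + φ (φ c) := by rw [← map_pow, e1, map_add, map_one]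
      simp only [map_mul, map_pow] at h0 ⊢
      rw [hn0]
      clear * - e0 hγ e1 e2 h0
      grind
    have hcγ : c = γ ^ 2 - 1 := by rw [hγ, add_sub_cancel_left]
    refine ⟨CharTwo.add_eq_zero.1 (hn.symm.trans hn0), ?_⟩
    rw [← hφc, hcγ]
    simp only [map_sub, map_pow, map_one, hγφ]
  · exfalso
    obtain ⟨γ, hγ⟩ := surjective_frobenius K 2 ((1 + c) / n)
    rw [frobenius_def, eq_div_iff hn0] at hγ
    have hγ0 : γ ≠ 0 := fun h0 => hc1 (by rw [← hγ, h0]; ring)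
    obtain ⟨s, hs, hs0⟩ := exists_norm_add_trace_mul_trace_sq_eq_zero hm hq φ hφF hφ hfix hz hγ0
    have hs1 : φ s ≠ 0 := (map_ne_zero φ).2 hs
    have hs2 : φ (φ s) ≠ 0 := (map_ne_zero φ).2 hs1
    obtain ⟨T, hT⟩ : ∃ T, T = s + φ s + φ (φ s) := ⟨_, rfl⟩
    rw [← hT] at hs0
    have hT0 : T ≠ 0 := fun h0 => by
      rw [h0, zero_mul, add_zero] at hs0
      exact mul_ne_zero (mul_ne_zero hs hs1) hs2 hs0
    have hφT : φ T = T := by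
      rw [hT, map_add, map_add, hφ]
      ring
    obtain ⟨σ, rfl⟩ : ∃ σ, s = T * σ := ⟨s / T, (mul_div_cancel₀ s hT0).symm⟩
    have hσ : σ + φ σ + φ (φ σ) = 1 := by
      refine mul_left_cancel₀ hT0 ?_
      simp only [map_mul, hφT] at hT
      linear_combination -hT
    refine key σ hσ ?_
    have e0 : (σ + φ σ + φ (φ σ)) ^ 2 = 1 := by rw [hσ, one_pow]
    have e1 : φ γ ^ 2 * n = 1 + φ c := by
      simpa only [map_mul, map_pow, map_add, map_one, hφn] using congrArg φ hγ
    have e2 : φ (φ γ) ^ 2 * n = 1 + φ (φ c) := by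
      simpa only [map_mul, map_pow, map_add, map_one, hφn] using congrArg φ e1
    have e3 : σ * φ σ * φ (φ σ) + (γ * σ + φ (γ * σ) + φ (φ (γ * σ))) ^ 2 = 0 := by
      refine (mul_eq_zero.1 (?_ : T ^ 3 * _ = 0)).resolve_left (pow_ne_zero 3 hT0)
      simp only [map_mul, hφT] at hs0 ⊢
      linear_combination hs0
    simp only [map_mul, map_pow] at e3 ⊢
    clear * - e0 hγ e1 e2 e3
    grind

end

theorem stmt_2 (m : ℕ) (hm : 19 ≤ m) (q : ℕ) (hq : q = 2 ^ m)
    (K : Type*) [Field K] [Fintype K] (hK : Fintype.card K = q ^ 3)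
    (A B : K) (hA : A ≠ 0) (hB : B ≠ 0)
    (hPP : Function.Bijective (fun x : K => x ^ (q ^ 2 - q + 1) + A * x ^ (q ^ 2) + B * x))
    (h1 : A ^ q * B ≠ 1)
    (hE : A ^ (1 + q + q ^ 2) + A * B ^ (q ^ 2) + A ^ q * B + A ^ (q ^ 2) * B ^ q +
        B ^ (1 + q + q ^ 2) + 1 ≠ 0) :
    A ^ (q ^ 2 + q + 1) = B ^ (1 + q + q ^ 2) ∧ (A ^ q * B) ^ q = A ^ q * B ∧
      A ^ q * B ≠ 0 ∧ A ^ q * B ≠ 1 := by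
  have hK' : Fintype.card K = 2 ^ (m * 3) := by rw [hK, hq, pow_mul]
  have h20 : (2 : K) = 0 := by
    have h := FiniteField.cast_card_eq_zero K
    rw [hK', Nat.cast_pow, Nat.cast_two] at h
    exact pow_eq_zero_iff (by omega) |>.1 h
  have : CharP K 2 := CharTwo.of_one_ne_zero_of_two_eq_zero one_ne_zero h20
  have : Fact (Nat.Prime 2) := ⟨Nat.prime_two⟩
  let _ : Algebra (ZMod 2) K := ZMod.algebra K 2
  have hdvd : Module.finrank (ZMod 2) (GaloisField 2 m) ∣ Module.finrank (ZMod 2) K := by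
    have h := Module.card_eq_pow_finrank (K := ZMod 2) (V := K)
    rw [hK', ZMod.card] at h
    rw [GaloisField.finrank 2 (by omega), ← Nat.pow_right_injective le_rfl h]
    exact dvd_mul_right m 3
  obtain ⟨ι⟩ := FiniteField.nonempty_algHom_of_finrank_dvd hdvd
  let _ : Algebra (GaloisField 2 m) K := ι.toRingHom.toAlgebra
  let _ : Fintype (GaloisField 2 m) := Fintype.ofFinite _
  have hF : Fintype.card (GaloisField 2 m) = 2 ^ m := by
    rw [← Nat.card_eq_fintype_card, GaloisField.card 2 m (by omega)]
  obtain ⟨φ, hφ⟩ : ∃ φ : K →+* K, ∀ x, φ x = x ^ q := ⟨iterateFrobenius K 2 m, fun x => by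
    rw [iterateFrobenius_def, hq]⟩
  have hφ2 : ∀ x, φ (φ x) = x ^ q ^ 2 := fun x => by rw [hφ, hφ, ← pow_mul, sq]
  have hφ3 : ∀ x, φ (φ (φ x)) = x := fun x => by
    rw [hφ, hφ2, ← pow_mul, ← pow_succ, ← hK, FiniteField.pow_card]
  have hfix : ∀ x, φ x = x → ∃ y, algebraMap (GaloisField 2 m) K y = x := fun x hx =>
    exists_algebraMap_eq_of_pow_card_eq (by rw [hF, ← hq, ← hφ, hx])
  have hq1 : 1 < q := hq ▸ Nat.one_lt_two_pow (by omega)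
  obtain ⟨z, hz⟩ : ∃ z, φ z ≠ z := by
    by_contra! hall
    have h := Fintype.card_le_of_surjective _ fun x => hfix x (hall x)
    rw [hF, ← hq, hK] at h
    nlinarith [Nat.pow_lt_pow_right hq1 (show 1 < 3 by norm_num)]
  obtain ⟨hN, hf⟩ := norm_eq_and_map_eq_self_of_injective (by omega) hF
    (fun y => by rw [hφ, ← map_pow, hq, ← hF, FiniteField.pow_card]) hφ3 hfix hz (A := A) (B := B)
    (fun x => by
      have hpow : x ^ (q ^ 2 - q + 1) = φ (φ x) * x / φ x := by
        by_cases hx : x = 0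
        · simp [hx]
        · rw [hφ2, hφ, eq_div_iff (pow_ne_zero _ hx), ← pow_add, ← pow_succ]
          congr 1
          have : q ≤ q ^ 2 := Nat.le_self_pow two_ne_zero q
          omega
      simp only [hpow, ← hφ2]) hPP.1 (by rwa [hφ])
  rw [hφ2, hφ2, hφ, hφ] at hN
  rw [hφ, hφ] at hf
  refine ⟨?_, hf, mul_ne_zero (pow_ne_zero _ hA) hB, h1⟩
  rw [pow_add, pow_add, pow_add, pow_add, pow_one, pow_one, ← hN]
  ring
end
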